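/- arXiv:2105.00692 — 4 statements merged into one kernel-verified Lean document; each statement's English description precedes it below -/
import Mathlib

section
/- Let R be a commutative Noetherian ring, M a finitely generated R-module, p a prime ideal of R, and s an element of R not in p such that s·H^i_q(M) = 0 for all integers i < grade(q,R), where q ranges over all ideals (in particular q = p). If moreover pR_p·M_p ≠ M_p, then depth of M_p over R_p is at least grade(p, R). -/
/-- The supremum of lengths of weakly regular `M`-sequences contained in `I`
(depth of `M` along `I`; `∞` for the zero module). -/
noncomputable def seqDepth {R : Type} [CommRing R] (I : Ideal R)
    (M : Type) [AddCommGroup M] [Module R M] : ℕ∞ :=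
  sSup {n : ℕ∞ | ∃ rs : List R, (∀ r ∈ rs, r ∈ I) ∧
    RingTheory.Sequence.IsWeaklyRegular M rs ∧ rs.length = n}

/-- `grade(I, R)`: the maximal length of an `R`-regular sequence contained in `I`. -/
noncomputable def Ideal.grade {R : Type} [CommRing R] (I : Ideal R) : ℕ∞ := seqDepth I R

/-- depth of the local ring `R_p`. -/
noncomputable def ringDepthAt (R : Type) [CommRing R] (p : Ideal R) [p.IsPrime] : ℕ∞ :=
  seqDepth (IsLocalRing.maximalIdeal (Localization.AtPrime p)) (Localization.AtPrime p)

/-- depth of the localized module `M_p` over the local ring `R_p`. -/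
noncomputable def moduleDepthAt {R : Type} [CommRing R] (p : Ideal R) [p.IsPrime]
    (M : Type) [AddCommGroup M] [Module R M] : ℕ∞ :=
  seqDepth (IsLocalRing.maximalIdeal (Localization.AtPrime p)) (LocalizedModule p.primeCompl M)

/-- `R` is Cohen–Macaulay: every localization at a prime is a Cohen–Macaulay local ring. -/
def IsCohenMacaulayRing (R : Type) [CommRing R] : Prop :=
  ∀ (p : Ideal R) (hp : p.IsPrime),
    haveI := hp
    (ringDepthAt R p : WithBot ℕ∞) = ringKrullDim (Localization.AtPrime p)

namespace LCaux
section cohom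
open CategoryTheory Limits Opposite

lemma old_ext_class {R : Type} [CommRing R] {X Y : ModuleCat.{0} R} (P : ProjectiveResolution X)
    (n : ℕ) (f : P.complex.X n ⟶ Y) (hf : P.complex.d (n+1) n ≫ f = 0) :
    ∃ c : ((_root_.Ext R (ModuleCat.{0} R) n).obj (op X)).obj Y,
      ∀ (X' : ModuleCat.{0} R) (g : X' ⟶ X) (P' : ProjectiveResolution X')
        (φ : P'.complex ⟶ P.complex) (comm : φ.f 0 ≫ P.π.f 0 = P'.π.f 0 ≫ g) (s : R),
        s • (((_root_.Ext R (ModuleCat.{0} R) n).map g.op).app Y).hom c = 0 →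
        ∃ h : P'.complex.X ((ComplexShape.down ℕ).next n) ⟶ Y,
          P'.complex.d n ((ComplexShape.down ℕ).next n) ≫ h = s • (φ.f n ≫ f) := by
  let F : ModuleCat.{0} R ⥤ (ModuleCat.{0} R)ᵒᵖ := ((linearYoneda R (ModuleCat.{0} R)).obj Y).rightOp
  let K := (F.mapHomologicalComplex (ComplexShape.down ℕ)).obj P.complex
  have hz : ∃ z : (K.opcycles n).unop, (K.pOpcycles n).unop.hom z = f := by
    have hex := (ShortComplex.exact_of_g_is_cokernel
      (ShortComplex.mk _ _ (K.d_pOpcycles (n+1) n)) (K.opcyclesIsCokernel (n+1) n (by simp))).unop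
    rw [ShortComplex.moduleCat_exact_iff] at hex
    exact hex f hf
  obtain ⟨z, hz⟩ := hz
  refine ⟨(P.isoLeftDerivedObj F n).hom.unop.hom ((K.homologyι n).unop.hom z), ?_⟩
  intro X' g P' φ comm s h
  let K' := (F.mapHomologicalComplex (ComplexShape.down ℕ)).obj P'.complex
  let Φ : K' ⟶ K := (F.mapHomologicalComplex (ComplexShape.down ℕ)).map φ
  have nat := congrArg Quiver.Hom.unop
    (ProjectiveResolution.isoLeftDerivedObj_hom_naturality g P' P φ comm F n)
  have nat2 := congrArg Quiver.Hom.unop (HomologicalComplex.homologyι_naturality Φ n)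
  have nat3 := congrArg Quiver.Hom.unop (HomologicalComplex.p_opcyclesMap Φ n)
  have e1 := congrArg (fun t => t.hom ((K.homologyι n).unop.hom z)) nat
  have e2 := congrArg (fun t => t.hom z) nat2
  have e3 := congrArg (fun t => t.hom z) nat3
  let z' : (K'.opcycles n).unop := s • (HomologicalComplex.opcyclesMap Φ n).unop.hom z
  have hz' : (K'.pOpcycles n).unop.hom z' = s • (φ.f n ≫ f) := by
    have : (K'.pOpcycles n).unop.hom ((HomologicalComplex.opcyclesMap Φ n).unop.hom z)
      = φ.f n ≫ f := by
      refine e3.trans ?_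
      change (Φ.f n).unop.hom ((K.pOpcycles n).unop.hom z) = _
      rw [hz]; rfl
    simp only [z', map_smul, this]
    rfl
  have h0 : (P'.isoLeftDerivedObj F n).hom.unop.hom ((K'.homologyι n).unop.hom z') = 0 := by
    simp only [z', map_smul]
    refine Eq.trans ?_ h
    have e5 := e1.trans (congrArg (fun t => (P'.isoLeftDerivedObj F n).hom.unop.hom t) e2)
    exact ((P'.isoLeftDerivedObj F n).hom.unop.hom.map_smul s _).trans
      (congrArg (fun t : ((F.leftDerived n).obj X').unop => s • t) e5.symm :)
  have h1 : (K'.homologyι n).unop.hom z' = 0 := by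
    have : Function.Injective (P'.isoLeftDerivedObj F n).hom.unop.hom :=
      (ModuleCat.mono_iff_injective _).1 inferInstance
    exact this (h0.trans (map_zero _).symm)
  have hex := (ShortComplex.exact_of_f_is_kernel
      (ShortComplex.mk _ _ (K'.homologyι_comp_fromOpcycles n _)) (K'.homologyIsKernel n _ rfl)).unop
  rw [ShortComplex.moduleCat_exact_iff] at hex
  obtain ⟨w, hw⟩ := hex z' h1
  refine ⟨w, ?_⟩
  rw [← hz']
  have e4 := congrArg (fun t => t.unop.hom w) (K'.p_fromOpcycles n ((ComplexShape.down ℕ).next n))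
  refine Eq.trans e4.symm ?_
  exact congrArg _ hw

open CategoryTheory.Abelian in
/-- every class of `Ext^i(R/p^j, M)` dies after localizing at `p` and increasing `j`. -/
def Van {R : Type} [CommRing R] (p : Ideal R) (i : ℕ) (M : ModuleCat.{0} R) : Prop :=
  ∀ (j : ℕ) (x : Abelian.Ext (ModuleCat.of R (R ⧸ p ^ j)) M i), ∃ (k : ℕ) (h : j ≤ k) (t : R),
    t ∉ p ∧ t • (Ext.mk₀ (ModuleCat.ofHom (Submodule.mapQ (p ^ k) (p ^ j) LinearMap.id
      (Ideal.pow_le_pow_right h)))).comp x (zero_add i) = 0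

lemma van_of_ann {R : Type} [CommRing R] (p : Ideal R) (s : R) (hs : s ∉ p) (i : ℕ)
    (M : ModuleCat.{0} R) (h : ∀ x : ((localCohomology p i).obj M), s • x = 0) : Van p i M := by
  intro j x
  let P := fun j : ℕ => projectiveResolution (ModuleCat.of R (R ⧸ p ^ j))
  obtain ⟨f, hf, rfl⟩ := (P j).extMk_surjective x (i+1) rfl
  obtain ⟨c, hc⟩ := old_ext_class (P j) i f hf
  let D := localCohomology.diagram (localCohomology.idealPowersDiagram p) i
  have : IsFiltered (ℕᵒᵖ)ᵒᵖ := inferInstance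
  have hcol := isColimitOfPreserves ((evaluation _ _).obj M) (colimit.isColimit D)
  have hz : ((colimit.ι D (op (op j))).app M).hom (s • c) =
      ((colimit.ι D (op (op j))).app M).hom 0 := by
    refine ((((colimit.ι D (op (op j))).app M).hom).map_smul s c).trans ?_
    exact (h _).trans (map_zero (((colimit.ι D (op (op j))).app M).hom)).symm
  obtain ⟨k, a, b, hk⟩ := Concrete.isColimit_exists_of_rep_eq _ hcol (i := op (op j)) (s • c) 0 hz
  have hjk : j ≤ k.unop.unop := leOfHom a.unop.unop
  refine ⟨k.unop.unop, hjk, s, hs, ?_⟩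
  set g : ModuleCat.of R (R ⧸ p ^ k.unop.unop) ⟶ ModuleCat.of R (R ⧸ p ^ j) :=
    ModuleCat.ofHom (Submodule.mapQ (p ^ k.unop.unop) (p ^ j) LinearMap.id
      (Ideal.pow_le_pow_right hjk)) with hg
  let φ := ProjectiveResolution.lift g (P _) (P j)
  have comm : φ.f 0 ≫ (P j).π.f 0 = (P _).π.f 0 ≫ g := by
    exact ProjectiveResolution.lift_commutes_zero g (P _) (P j)
  obtain ⟨w, hw⟩ := hc _ g (P _) φ comm s (by
    have := hk.trans (map_zero _)
    rw [← map_smul]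
    exact this)
  rw [ProjectiveResolution.mk₀_comp_extMk f (i+1) rfl hf (R' := P _) (g := g) ⟨φ, by simpa using comm⟩]
  rw [Abelian.Ext.smul_eq_comp_mk₀, ProjectiveResolution.extMk_comp_mk₀]
  cases i with
  | zero =>
    have : s • (φ.f 0 ≫ f) = 0 := by
      rw [← hw, HomologicalComplex.shape, zero_comp]
      simp
    convert ProjectiveResolution.extMk_zero _ 1 rfl
    simpa using this
  | succ i =>
    rw [ProjectiveResolution.extMk_eq_zero_iff _ _ _ _ _ i rfl]
    have e : (ComplexShape.down ℕ).next (i+1) = i := by simp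
    generalize (ComplexShape.down ℕ).next (i+1) = q at w hw e
    subst e
    refine ⟨w, ?_⟩
    simpa using hw

open CategoryTheory.Abelian

/-- the transition maps -/
noncomputable abbrev tr {R : Type} [CommRing R] (p : Ideal R) {j k : ℕ} (h : j ≤ k) :
    ModuleCat.of R (R ⧸ p ^ k) ⟶ ModuleCat.of R (R ⧸ p ^ j) :=
  ModuleCat.ofHom (Submodule.mapQ (p ^ k) (p ^ j) LinearMap.id (Ideal.pow_le_pow_right h))

lemma tr_comp {R : Type} [CommRing R] (p : Ideal R) {j k l : ℕ} (h : j ≤ k) (h' : k ≤ l) :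
    tr p h' ≫ tr p h = tr p (h.trans h') := by
  ext
  rfl

lemma van_ses {R : Type} [CommRing R] (p : Ideal R) [p.IsPrime] (i : ℕ)
    (S : ShortComplex (ModuleCat.{0} R)) (hS : S.ShortExact) (h2 : Van p i S.X₂)
    (h1 : Van p (i+1) S.X₁) : Van p i S.X₃ := by
  intro j x
  obtain ⟨k, hk, t, ht, e⟩ := h1 j (x.comp hS.extClass rfl)
  obtain ⟨y, hy⟩ := Ext.covariant_sequence_exact₃ _ hS
    (t • (Ext.mk₀ (tr p hk)).comp x (zero_add i)) rfl (by
      rw [Ext.smul_comp, Ext.comp_assoc _ _ _ (zero_add i) rfl (by omega)]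
      exact e)
  obtain ⟨l, hl, u, hu, e'⟩ := h2 k y
  refine ⟨l, hk.trans hl, u * t, fun hh => (Ideal.IsPrime.mem_or_mem ‹_› hh).elim hu ht, ?_⟩
  have e2 := congrArg (fun z => z.comp (Ext.mk₀ S.g) (add_zero i)) e'
  simp only [Ext.smul_comp, Ext.zero_comp] at e2
  rw [Ext.comp_assoc _ _ _ (zero_add i) (add_zero i) (by omega), hy, Ext.comp_smul,
    smul_smul, Ext.mk₀_comp_mk₀_assoc, tr_comp p hk hl] at e2
  exact e2

lemma van_of_killed {R : Type} [CommRing R] (p : Ideal R) (i : ℕ)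
    (M : ModuleCat.{0} R) (t : R) (ht : t ∉ p) (h : ∀ y : M, t • y = 0) : Van p i M := by
  intro j x
  refine ⟨j, le_rfl, t, ht, ?_⟩
  have : t • 𝟙 M = 0 := by
    ext y
    exact h y
  rw [Ext.smul_eq_comp_mk₀, this]
  simp

lemma ses_of_sub {R M : Type} [CommRing R] [AddCommGroup M] [Module R M] {Q : Type}
    [AddCommGroup Q] [Module R Q] (g : M →ₗ[R] Q) (hg : Function.Surjective g) :
    (ModuleCat.shortComplexOfCompEqZero (LinearMap.ker g).subtype g (by ext y; exact y.2)).ShortExact where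
  exact := ModuleCat.shortComplex_exact _ (LinearMap.exact_subtype_ker_map g)
  mono_f := (ModuleCat.mono_iff_injective _).2 (Submodule.subtype_injective _)
  epi_g := (ModuleCat.epi_iff_surjective _).2 hg

lemma van_congr {R : Type} [CommRing R] (p : Ideal R) (i : ℕ)
    (M N : ModuleCat.{0} R) (e : M ≅ N) (h : Van p i M) : Van p i N := by
  intro j x
  obtain ⟨k, hk, t, ht, e1⟩ := h j (x.comp (Ext.mk₀ e.inv) (add_zero i))
  refine ⟨k, hk, t, ht, ?_⟩
  have e2 := congrArg (fun z => z.comp (Ext.mk₀ e.hom) (add_zero i)) e1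
  simpa [Ext.smul_comp, Ext.comp_assoc_of_third_deg_zero, Ext.mk₀_comp_mk₀] using e2

open Pointwise in
lemma van_quot {R M : Type} [CommRing R] [AddCommGroup M] [Module R M] (p : Ideal R) [p.IsPrime]
    (i : ℕ) (x t : R) (ht : t ∉ p) (hker : ∀ y : M, x • y = 0 → t • y = 0)
    (h0 : Van p i (ModuleCat.of R M)) (h1 : Van p (i+1) (ModuleCat.of R M)) :
    Van p i (ModuleCat.of R (QuotSMulTop x M)) := by
  let m : M →ₗ[R] M := LinearMap.lsmul R M x
  have a := van_ses p (i+1) _ (ses_of_sub m.rangeRestrict m.surjective_rangeRestrict) h1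
    (van_of_killed p _ _ t ht (by
      rintro ⟨y, hy⟩
      have hy' : x • y = 0 := congrArg Subtype.val (LinearMap.mem_ker.1 hy)
      exact Subtype.ext (hker y hy')))
  refine van_ses p i _ (ses_of_sub (x • (⊤ : Submodule R M)).mkQ (Submodule.mkQ_surjective _)) h0 ?_
  refine van_congr p (i+1) _ _ ?_ a
  refine (LinearEquiv.ofEq m.range (LinearMap.ker (x • (⊤ : Submodule R M)).mkQ) ?_).toModuleIso
  exact (LinearMap.exact_iff.1 (LinearMap.exact_lsmul_mkQ_smul_top M x)).symm

lemma van_zero {R M : Type} [CommRing R] [AddCommGroup M] [Module R M] (p : Ideal R)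
    (h : Van p 0 (ModuleCat.of R M)) (y : M) (hy : ∀ a ∈ p, a • y = 0) :
    ∃ t, t ∉ p ∧ t • y = 0 := by
  let φ : (R ⧸ p ^ 1) →ₗ[R] M := Submodule.liftQ _ (LinearMap.toSpanSingleton R M y) (by
    intro a ha
    rw [pow_one] at ha
    exact hy a ha)
  obtain ⟨k, hk, t, ht, e⟩ := h 1 (Ext.mk₀ (ModuleCat.ofHom φ))
  refine ⟨t, ht, ?_⟩
  rw [Ext.mk₀_comp_mk₀, ← Ext.mk₀_smul, Ext.mk₀_eq_zero_iff] at e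
  have := congrArg (fun f => f.hom (Submodule.Quotient.mk 1)) e
  change t • ((1 : R) • y) = 0 at this
  simpa using this

end cohom

section loc
open Pointwise

lemma isLoc_quot {R M N : Type} [CommRing R] [AddCommGroup M] [AddCommGroup N] [Module R M]
    [Module R N] (S : Submonoid R) (f : M →ₗ[R] N) [IsLocalizedModule S f] (x : R) :
    IsLocalizedModule S (QuotSMulTop.map x f) where
  map_units s := by
    obtain ⟨u, hu⟩ := IsLocalizedModule.map_units f s
    refine ⟨⟨QuotSMulTop.map x (u : Module.End R N), QuotSMulTop.map x (↑u⁻¹ : Module.End R N),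
      ?_, ?_⟩, ?_⟩
    · rw [Module.End.mul_eq_comp, ← QuotSMulTop.map_comp, ← Module.End.mul_eq_comp, Units.mul_inv]
      exact QuotSMulTop.map_id x N
    · rw [Module.End.mul_eq_comp, ← QuotSMulTop.map_comp, ← Module.End.mul_eq_comp, Units.inv_mul]
      exact QuotSMulTop.map_id x N
    · simp only [hu]
      ext y
      rfl
  surj y := by
    obtain ⟨y, rfl⟩ := Submodule.Quotient.mk_surjective _ y
    obtain ⟨⟨m, s⟩, h⟩ := IsLocalizedModule.surj S f y
    refine ⟨⟨Submodule.Quotient.mk m, s⟩, ?_⟩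
    simp only [QuotSMulTop.map_apply_mk]
    rw [← h]; rfl
  exists_of_eq {a b} h := by
    obtain ⟨a, rfl⟩ := Submodule.Quotient.mk_surjective _ a
    obtain ⟨b, rfl⟩ := Submodule.Quotient.mk_surjective _ b
    simp only [QuotSMulTop.map_apply_mk] at h
    rw [Submodule.Quotient.eq, Submodule.mem_smul_pointwise_iff_exists] at h
    obtain ⟨n, -, hn⟩ := h
    obtain ⟨⟨m, s⟩, hm⟩ := IsLocalizedModule.surj S f n
    have : f (s • (a - b)) = f (x • m) := by
      rw [Submonoid.smul_def, map_smul, map_sub, ← hn, map_smul, ← hm, Submonoid.smul_def,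
        smul_comm]
    obtain ⟨c, hc⟩ := IsLocalizedModule.exists_of_eq (S := S) this
    refine ⟨c * s, ?_⟩
    change Submodule.Quotient.mk ((c * s) • a) = Submodule.Quotient.mk ((c * s) • b)
    rw [Submodule.Quotient.eq, Submodule.mem_smul_pointwise_iff_exists]
    refine ⟨c • m, trivial, ?_⟩
    rw [← smul_sub, mul_smul, hc, smul_comm]

lemma fg_ker {R M : Type} [CommRing R] [AddCommGroup M] [Module R M] (p : Ideal R) [p.IsPrime]
    (N : Submodule R M) (hN : N.FG) (h : ∀ y ∈ N, ∃ t, t ∉ p ∧ t • y = 0) :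
    ∃ t, t ∉ p ∧ ∀ y ∈ N, t • y = 0 := by
  induction N, hN using Submodule.fg_induction with
  | singleton x =>
    obtain ⟨t, ht, h⟩ := h x (Submodule.mem_span_singleton_self x)
    refine ⟨t, ht, fun y hy => ?_⟩
    obtain ⟨a, rfl⟩ := Submodule.mem_span_singleton.1 hy
    rw [smul_comm, h, smul_zero]
  | sup N₁ N₂ _ _ h1 h2 =>
    obtain ⟨t, ht, h1⟩ := h1 fun y hy => h y (Submodule.mem_sup_left hy)
    obtain ⟨u, hu, h2⟩ := h2 fun y hy => h y (Submodule.mem_sup_right hy)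
    refine ⟨t * u, fun hh => (Ideal.IsPrime.mem_or_mem ‹_› hh).elim ht hu, fun y hy => ?_⟩
    obtain ⟨a, ha, b, hb, rfl⟩ := Submodule.mem_sup.1 hy
    rw [smul_add, mul_smul, mul_smul, h2 b hb, smul_comm, h1 a ha]; simp

lemma exists_reg {R M : Type} [CommRing R] [IsNoetherianRing R] [AddCommGroup M] [Module R M]
    [Module.Finite R M] (p : Ideal R) [p.IsPrime]
    (h : ∀ y : M, (∀ a ∈ p, a • y = 0) → ∃ t, t ∉ p ∧ t • y = 0) :
    ∃ x ∈ p, IsSMulRegular (LocalizedModule p.primeCompl M) x := by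
  let A := Localization.AtPrime p
  let L := LocalizedModule p.primeCompl M
  have : Module.Finite A L := Module.Finite.of_isLocalizedModule p.primeCompl
    (LocalizedModule.mkLinearMap p.primeCompl M)
  have : IsNoetherianRing A := IsLocalization.isNoetherianRing p.primeCompl A inferInstance
  have hsub : Subsingleton ((A ⧸ IsLocalRing.maximalIdeal A) →ₗ[A] L) := by
    refine subsingleton_of_forall_eq 0 fun φ => ?_
    ext
    obtain ⟨⟨m, u⟩, hy⟩ := IsLocalizedModule.mk'_surjective p.primeCompl
      (LocalizedModule.mkLinearMap p.primeCompl M) (φ (Submodule.Quotient.mk 1))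
    have hm : ∀ a ∈ p, a • (φ (Submodule.Quotient.mk 1)) = 0 := by
      intro a ha
      rw [← IsScalarTower.algebraMap_smul A a, ← map_smul, ← Submodule.Quotient.mk_smul,
        (Submodule.Quotient.mk_eq_zero _).2, map_zero]
      rw [smul_eq_mul, mul_one, ← Localization.AtPrime.map_eq_maximalIdeal]
      exact Ideal.mem_map_of_mem _ ha
    have h1 : ∀ a ∈ p, ∃ t, t ∉ p ∧ t • a • m = 0 := by
      intro a ha
      have := hm a ha
      rw [← hy, Function.uncurry_apply_pair, ← IsLocalizedModule.mk'_smul,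
        IsLocalizedModule.mk'_eq_zero'] at this
      obtain ⟨s, hs⟩ := this
      exact ⟨s, s.2, hs⟩
    obtain ⟨t, ht, h2⟩ := fg_ker p (Submodule.map (LinearMap.toSpanSingleton R M m) p)
      ((IsNoetherian.noetherian (p : Submodule R R)).map _) (by
        rintro _ ⟨a, ha, rfl⟩
        exact h1 a ha)
    obtain ⟨t', ht', h3⟩ := h (t • m) fun a ha => by
      rw [smul_comm]; exact h2 _ ⟨a, ha, rfl⟩
    have : φ (Submodule.Quotient.mk 1) = 0 := by
      rw [← hy, Function.uncurry_apply_pair, IsLocalizedModule.mk'_eq_zero']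
      refine ⟨⟨t' * t, fun hh => (Ideal.IsPrime.mem_or_mem ‹_› hh).elim ht' ht⟩, ?_⟩
      rw [Submonoid.smul_def, mul_smul]; exact h3
    simpa using this
  obtain ⟨r, hr, hreg⟩ := IsSMulRegular.subsingleton_linearMap_iff.1 hsub
  rw [Ideal.annihilator_quotient] at hr
  obtain ⟨⟨x, u⟩, hx⟩ := IsLocalization.surj p.primeCompl r
  simp only at hx
  have hxr : algebraMap R A x ∈ IsLocalRing.maximalIdeal A := by
    rw [← hx]; exact Ideal.mul_mem_right _ _ hr
  refine ⟨x, (IsLocalization.AtPrime.to_map_mem_maximal_iff A p x).1 hxr, ?_⟩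
  intro a b hab
  simp only [← IsScalarTower.algebraMap_smul A x, ← hx] at hab
  have hu : IsUnit (algebraMap R A u) := IsLocalization.map_units A u
  exact (hreg.mul (hu.isSMulRegular L)) hab


lemma main_ind {R : Type} [CommRing R] [IsNoetherianRing R] (p : Ideal R) [p.IsPrime] (n : ℕ) :
    ∀ (M N : Type) [AddCommGroup M] [AddCommGroup N] [Module R M] [Module R N] [Module.Finite R M]
      (f : M →ₗ[R] N) [IsLocalizedModule p.primeCompl f],
      (∀ i < n, Van p i (ModuleCat.of R M)) →
      ∃ rs : List R, rs.length = n ∧ (∀ r ∈ rs, r ∈ p) ∧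
        RingTheory.Sequence.IsWeaklyRegular N rs := by
  induction n with
  | zero =>
    intro M N _ _ _ _ _ f _ _
    exact ⟨[], rfl, by simp, RingTheory.Sequence.IsWeaklyRegular.nil R N⟩
  | succ n ih =>
    intro M N _ _ _ _ _ f _ hv
    obtain ⟨x, hx, hreg⟩ := exists_reg p (van_zero p (hv 0 (Nat.succ_pos n)))
    have hregN : IsSMulRegular N x :=
      (LinearEquiv.isSMulRegular_congr (IsLocalizedModule.iso p.primeCompl f) x).1 hreg
    obtain ⟨t, ht, hk⟩ := fg_ker p (LinearMap.ker (LinearMap.lsmul R M x))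
      (IsNoetherian.noetherian _) (by
        intro y hy
        have hy' : x • y = 0 := hy
        have h0 : f y = 0 := by
          apply hregN
          simp only [smul_zero]
          rw [← map_smul, hy', map_zero]
        obtain ⟨c, hc⟩ := (IsLocalizedModule.eq_zero_iff p.primeCompl f).1 h0
        exact ⟨c, c.2, hc⟩)
    haveI := isLoc_quot p.primeCompl f x
    obtain ⟨rs, hl, hm, hr⟩ := ih (QuotSMulTop x M) (QuotSMulTop x N) (QuotSMulTop.map x f)
      (fun i hi => van_quot p i x t ht (fun y hy => hk y hy) (hv i (by omega))
        (hv (i + 1) (by omega)))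
    refine ⟨x :: rs, by simp [hl], ?_, hr.cons hregN⟩
    intro r hr'
    rcases List.mem_cons.1 hr' with rfl | h
    · exact hx
    · exact hm r h

end loc

end LCaux

theorem stmt0 {R : Type} [CommRing R] [IsNoetherianRing R]
    (M : Type) [AddCommGroup M] [Module R M] [Module.Finite R M]
    (p : Ideal R) [p.IsPrime] (s : R) (hs : s ∉ p)
    (hann : ∀ (q : Ideal R) (i : ℕ), (i : ℕ∞) < q.grade →
      ∀ x : ((localCohomology q i).obj (ModuleCat.of R M)), s • x = 0)
    (hne : (p.map (algebraMap R (Localization.AtPrime p))) •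
        (⊤ : Submodule (Localization.AtPrime p) (LocalizedModule p.primeCompl M)) ≠ ⊤) :
    p.grade ≤ moduleDepthAt p M := by 
  refine sSup_le ?_
  rintro n ⟨rs, hrs, hreg, rfl⟩
  have hle : (rs.length : ℕ∞) ≤ p.grade := le_sSup ⟨rs, hrs, hreg, rfl⟩
  obtain ⟨rs', hl, hm, hr⟩ := LCaux.main_ind p rs.length M (LocalizedModule p.primeCompl M)
    (LocalizedModule.mkLinearMap p.primeCompl M) (fun i hi =>
      LCaux.van_of_ann p s hs i _ (hann p i (lt_of_lt_of_le (by exact_mod_cast hi) hle)))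
  refine le_sSup ⟨rs'.map (algebraMap R (Localization.AtPrime p)), ?_, ?_, ?_⟩
  · intro r hr'
    obtain ⟨a, ha, rfl⟩ := List.mem_map.1 hr'
    exact (IsLocalization.AtPrime.to_map_mem_maximal_iff _ p a).2 (hm a ha)
  · exact (RingTheory.Sequence.isWeaklyRegular_map_algebraMap_iff _ _ _).2 hr
  · rw [List.length_map, hl]
end

section
/- Let R be a Cohen-Macaulay commutative Noetherian ring, p a prime ideal, and M a finitely generated R-module with depth M_p ≥ depth R_p. Then for every prime ideal q ⊆ p, depth M_q ≥ depth R_q. -/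
open RingTheory.Sequence CategoryTheory CategoryTheory.Abelian IsLocalRing Pointwise

/-- Depth is at most the dimension of any associated prime. -/
lemma length_le_coheight_of_assoc {S : Type} [CommRing S] [IsNoetherianRing S] [IsLocalRing S]
    (rs : List S) : ∀ (N : Type) [AddCommGroup N] [Module S N] [Module.Finite S N]
    (_ : ∀ r ∈ rs, r ∈ maximalIdeal S) (_ : IsWeaklyRegular N rs)
    (P : PrimeSpectrum S) (_ : IsAssociatedPrime P.asIdeal N),
    (rs.length : ℕ∞) ≤ Order.coheight P := by
  induction rs with
  | nil => intros; simp
  | cons x rs ih =>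
    intro N _ _ _ hmem hreg P hP
    rw [isWeaklyRegular_cons_iff] at hreg
    obtain ⟨hx, hrs⟩ := hreg
    have hxm : x ∈ maximalIdeal S := hmem x (by simp)
    obtain ⟨-, y, hy⟩ := isAssociatedPrime_iff.mp hP
    have hy' : ∀ a, a ∈ P.asIdeal ↔ a • y = 0 := by
      intro a
      rw [hy, Submodule.mem_colon_singleton, Submodule.mem_bot]
    have hy0 : y ≠ 0 := by
      rintro rfl
      exact P.2.ne_top ((Ideal.eq_top_iff_one _).mpr ((hy' 1).mpr (by simp)))
    have hxP : x ∉ P.asIdeal := by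
      intro hxP
      exact hy0 (hx (by simpa using (hy' x).mp hxP))
    -- the submodule killed by `P`
    let L : Submodule S N :=
      { carrier := {z | ∀ a ∈ P.asIdeal, a • z = 0}
        add_mem' := by
          intro u v hu hv a ha
          rw [smul_add, hu a ha, hv a ha, add_zero]
        zero_mem' := by intro a _; simp
        smul_mem' := by
          intro c u hu a ha
          rw [smul_comm, hu a ha, smul_zero] }
    have hyL : y ∈ L := fun a ha => (hy' a).mp ha
    have hex : ∃ z ∈ L, z ∉ x • (⊤ : Submodule S N) := by
      by_contra! hcon
      have hL : L ≤ maximalIdeal S • L := by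
        intro z hz
        obtain ⟨w, -, rfl⟩ := (Submodule.mem_smul_pointwise_iff_exists _ _ _).mp (hcon z hz)
        refine Submodule.smul_mem_smul hxm ?_
        intro a ha
        refine hx ?_
        change x • a • w = x • 0
        rw [smul_comm, smul_zero]
        exact hz a ha
      have := Submodule.eq_bot_of_le_smul_of_le_jacobson_bot _ L (IsNoetherian.noetherian L) hL
        (maximalIdeal_le_jacobson _)
      rw [this] at hyL
      exact hy0 (by simpa using hyL)
    obtain ⟨z, hzL, hz⟩ := hex
    have hz0 : (Submodule.Quotient.mk z : QuotSMulTop x N) ≠ 0 := by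
      intro h0
      exact hz ((Submodule.Quotient.mk_eq_zero _).mp h0)
    obtain ⟨P', hP', hle⟩ := exists_le_isAssociatedPrime_of_isNoetherianRing S _ hz0
    have key := ih (QuotSMulTop x N) (fun r hr => hmem r (by simp [hr])) hrs
      ⟨P', hP'.isPrime⟩ hP'
    have hlt : P < ⟨P', hP'.isPrime⟩ := by
      refine lt_of_le_of_ne ?_ ?_
      · intro a ha
        apply hle
        rw [Submodule.mem_colon_singleton, Submodule.mem_bot, ← Submodule.Quotient.mk_smul,
          hzL a ha]
        rfl
      · intro he
        apply hxP
        rw [he]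
        apply hle
        rw [Submodule.mem_colon_singleton, Submodule.mem_bot, ← Submodule.Quotient.mk_smul]
        exact (Submodule.Quotient.mk_eq_zero _).mpr
          (Submodule.smul_mem_pointwise_smul _ _ _ trivial)
    calc ((x :: rs).length : ℕ∞) = rs.length + 1 := by simp
      _ ≤ _ + 1 := by gcongr
      _ ≤ _ := Order.coheight_add_one_le hlt

lemma smul_top_lt_top_of_local {S : Type} [CommRing S] [IsLocalRing S]
    (N : Type) [AddCommGroup N] [Module S N] [Module.Finite S N] [Nontrivial N] :
    maximalIdeal S • (⊤ : Submodule S N) < ⊤ :=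
  (Submodule.top_ne_ideal_smul_of_le_jacobson_annihilator
    (maximalIdeal_le_jacobson _)).symm.lt_top

/-- Depth drops by at most one modulo a regular element. -/
lemma exists_regular_quot {S : Type} [CommRing S] [IsNoetherianRing S] [IsLocalRing S]
    (N : Type) [AddCommGroup N] [Module S N] [Module.Finite S N] [Nontrivial N]
    (x : S) (hxm : x ∈ maximalIdeal S) (hx : IsSMulRegular N x) (n : ℕ)
    (h : ∃ rs : List S, rs.length = n + 1 ∧ (∀ r ∈ rs, r ∈ maximalIdeal S) ∧ IsRegular N rs) :
    Nontrivial (QuotSMulTop x N) ∧ ∃ rs : List S, rs.length = n ∧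
      (∀ r ∈ rs, r ∈ maximalIdeal S) ∧ IsRegular (QuotSMulTop x N) rs := by
  have hnt : Nontrivial (QuotSMulTop x N) := by
    have h1 : IsRegular N [x] :=
      (isRegular_iff_isWeaklyRegular_of_subset_maximalIdeal (by simpa using hxm)).mpr
        ((isWeaklyRegular_singleton_iff N x).mpr hx)
    exact ((isRegular_cons_iff N x []).mp h1).2.nontrivial
  refine ⟨hnt, ?_⟩
  have t1 := ModuleCat.exists_isRegular_tfae.{0} (maximalIdeal S) (n + 1) (ModuleCat.of S N)
    (smul_top_lt_top_of_local N)
  have t2 := ModuleCat.exists_isRegular_tfae.{0} (maximalIdeal S) n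
    (ModuleCat.of S (QuotSMulTop x N)) (smul_top_lt_top_of_local (QuotSMulTop x N))
  have h_ext := (t1.out 1 3).mpr h
  refine (t2.out 1 3).mp ?_
  intro i hi
  have zero1 := AddCommGrpCat.isZero_of_iff_subsingleton.mpr (h_ext i (by omega))
  have zero2 := AddCommGrpCat.isZero_of_iff_subsingleton.mpr (h_ext (i + 1) (by omega))
  exact AddCommGrpCat.subsingleton_of_isZero <| ShortComplex.Exact.isZero_of_both_zeros
    ((Ext.covariant_sequence_exact₃' _
      (IsSMulRegular.smulShortComplex_shortExact (M := ModuleCat.of S N) hx)) i (i + 1) rfl)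
    (zero1.eq_zero_of_src _) (zero2.eq_zero_of_tgt _)

lemma exists_regular_in_prime {S : Type} [CommRing S] [IsNoetherianRing S] [IsLocalRing S]
    (Q : PrimeSpectrum S) (k : ℕ) : ∀ (n : ℕ) (N : Type) [AddCommGroup N] [Module S N]
    [Module.Finite S N] [Nontrivial N]
    (_ : ∃ rs : List S, rs.length = n ∧ (∀ r ∈ rs, r ∈ maximalIdeal S) ∧ IsRegular N rs)
    (_ : (k : ℕ∞) + Order.coheight Q ≤ n),
    ∃ rs : List S, rs.length = k ∧ (∀ r ∈ rs, r ∈ Q.asIdeal) ∧ IsWeaklyRegular N rs := by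
  induction k with
  | zero => intros; exact ⟨[], by simp⟩
  | succ k ih =>
    intro n N _ _ _ _ hrs hk
    obtain ⟨c, hc⟩ : ∃ c : ℕ, Order.coheight Q = c := by
      refine ENat.ne_top_iff_exists.mp ?_ |>.imp fun _ h => h.symm
      rintro h
      rw [h] at hk
      simp at hk
    rw [hc] at hk
    have hk' : k + 1 + c ≤ n := by exact_mod_cast hk
    by_cases hreg : ∃ x ∈ Q.asIdeal, IsSMulRegular N x
    · obtain ⟨x, hxQ, hx⟩ := hreg
      obtain ⟨m, rfl⟩ : ∃ m, n = m + 1 := ⟨n - 1, by omega⟩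
      obtain ⟨hnt, h'⟩ := exists_regular_quot N x (le_maximalIdeal Q.2.ne_top hxQ) hx m hrs
      obtain ⟨rs, hl, hm, hr⟩ := ih m (QuotSMulTop x N) h' (by
        rw [hc]; exact_mod_cast (by omega : k + c ≤ m))
      refine ⟨x :: rs, by simp [hl], ?_, .cons hx hr⟩
      intro r hr
      rcases List.mem_cons.mp hr with rfl | hr
      exacts [hxQ, hm r hr]
    · exfalso
      push Not at hreg
      have hsub : (Q.asIdeal : Set S) ⊆ ⋃ p ∈ associatedPrimes S N, (p : Set S) := by
        rw [biUnion_associatedPrimes_eq_compl_regular S N]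
        exact hreg
      obtain ⟨P, hP, hQP⟩ := (Ideal.subset_union_prime_finite (f := fun p => p)
        (associatedPrimes.finite S N) ⊤ ⊤
        (fun I hI _ _ => IsAssociatedPrime.isPrime hI)).mp hsub
      have hPp : P.IsPrime := IsAssociatedPrime.isPrime hP
      obtain ⟨rs, hl, hm, hr⟩ := hrs
      have h1 := length_le_coheight_of_assoc rs N hm hr.toIsWeaklyRegular ⟨P, hPp⟩ hP
      have h2 : Order.coheight (⟨P, hPp⟩ : PrimeSpectrum S) ≤ Order.coheight Q :=
        Order.coheight_anti (show Q ≤ ⟨P, hPp⟩ from hQP)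
      have h3 := h1.trans h2
      rw [hc, hl] at h3
      have : n ≤ c := by exact_mod_cast h3
      omega

lemma isWeaklyRegular_of_subsingleton {S N : Type} [CommRing S] [AddCommGroup N] [Module S N]
    [Subsingleton N] (rs : List S) : IsWeaklyRegular N rs := by
  rw [isWeaklyRegular_iff_Fin]
  intro i a b _
  exact Subsingleton.elim _ _

lemma exists_of_le_seqDepth {S : Type} [CommRing S] (I : Ideal S) (N : Type) [AddCommGroup N]
    [Module S N] (n : ℕ) (h : (n : ℕ∞) ≤ seqDepth I N) :
    ∃ rs : List S, rs.length = n ∧ (∀ r ∈ rs, r ∈ I) ∧ IsWeaklyRegular N rs := by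
  have : ∃ rs : List S, n ≤ rs.length ∧ (∀ r ∈ rs, r ∈ I) ∧ IsWeaklyRegular N rs := by
    rcases n with _ | n
    · exact ⟨[], by simp⟩
    · have hlt : (n : ℕ∞) < seqDepth I N := lt_of_lt_of_le (by exact_mod_cast n.lt_succ_self) h
      obtain ⟨_, ⟨rs, h1, h2, rfl⟩, hl⟩ := lt_sSup_iff.mp hlt
      exact ⟨rs, by exact_mod_cast hl, h1, h2⟩
  obtain ⟨rs, hl, hm, hr⟩ := this
  refine ⟨rs.take n, by simpa using hl, fun r hr => hm r (List.mem_of_mem_take hr), ?_⟩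
  rw [← List.take_append_drop n rs, isWeaklyRegular_append_iff] at hr
  exact hr.1

theorem stmt8 {R : Type} [CommRing R] [IsNoetherianRing R] (hCM : IsCohenMacaulayRing R)
    (p q : Ideal R) [p.IsPrime] [q.IsPrime] (hqp : q ≤ p)
    (M : Type) [AddCommGroup M] [Module R M] [Module.Finite R M]
    (h : ringDepthAt R p ≤ moduleDepthAt p M) :
    ringDepthAt R q ≤ moduleDepthAt q M := by
  have hp : ringDepthAt R p = p.height := by
    have := hCM p ‹_›
    rw [IsLocalization.AtPrime.ringKrullDim_eq_height p] at this
    exact_mod_cast this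
  have hq : ringDepthAt R q = q.height := by
    have := hCM q ‹_›
    rw [IsLocalization.AtPrime.ringKrullDim_eq_height q] at this
    exact_mod_cast this
  obtain ⟨n, hn⟩ : ∃ n : ℕ, p.height = n :=
    (ENat.ne_top_iff_exists.mp (Ideal.height_ne_top Ideal.IsPrime.ne_top')).imp fun _ h => h.symm
  obtain ⟨k, hk⟩ : ∃ k : ℕ, q.height = k :=
    (ENat.ne_top_iff_exists.mp (Ideal.height_ne_top Ideal.IsPrime.ne_top')).imp fun _ h => h.symm
  rw [hp, hn] at h
  rw [hq, hk]
  let S := Localization.AtPrime p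
  let T := Localization.AtPrime q
  let N := LocalizedModule p.primeCompl M
  let O := LocalizedModule q.primeCompl M
  have hle : p.primeCompl ≤ q.primeCompl := fun x hx hxq => hx (hqp hxq)
  let : Algebra S T := IsLocalization.localizationAlgebraOfSubmonoidLe S T _ _ hle
  have : IsScalarTower R S T :=
    IsLocalization.localization_isScalarTower_of_submonoid_le S T _ _ hle
  have : IsLocalization (Submonoid.map (algebraMap R S) q.primeCompl) T :=
    IsLocalization.isLocalization_of_submonoid_le S T _ _ hle
  have : Module.Flat S T := IsLocalization.flat T (Submonoid.map (algebraMap R S) q.primeCompl)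
  let Q : PrimeSpectrum S := ⟨(maximalIdeal T).comap (algebraMap S T), inferInstance⟩
  have hQ : Q.asIdeal.comap (algebraMap R S) = q := by
    change ((maximalIdeal T).comap (algebraMap S T)).comap (algebraMap R S) = q
    rw [Ideal.comap_comap, ← IsScalarTower.algebraMap_eq]
    exact Localization.AtPrime.under_maximalIdeal
  have hQh : Order.height Q = k := by
    rw [← PrimeSpectrum.height_eq_orderHeight, ← IsLocalization.height_under p.primeCompl, ← hk]
    exact congrArg Ideal.height hQ
  obtain ⟨rs, hl, hm, hr⟩ : ∃ rs : List S, rs.length = k ∧ (∀ r ∈ rs, r ∈ Q.asIdeal) ∧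
      IsWeaklyRegular N rs := by
    rcases subsingleton_or_nontrivial N with hN | hN
    · refine ⟨List.replicate k 0, by simp, ?_, isWeaklyRegular_of_subsingleton _⟩
      intro r hr
      rw [List.eq_of_mem_replicate hr]
      exact zero_mem _
    · obtain ⟨rs, hl, hm, hr⟩ := exists_of_le_seqDepth _ _ n h
      refine exists_regular_in_prime Q k n N ⟨rs, hl, hm,
        (isRegular_iff_isWeaklyRegular_of_subset_maximalIdeal hm).mpr hr⟩ ?_
      have hdim : Order.krullDim (PrimeSpectrum S) = (n : ℕ∞) := by
        rw [← hn]
        exact IsLocalization.AtPrime.ringKrullDim_eq_height p S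
      rw [Order.krullDim_eq_iSup_height_add_coheight_of_nonempty, WithBot.coe_inj] at hdim
      rw [← hQh, ← hdim]
      exact le_iSup (fun a : PrimeSpectrum S => Order.height a + Order.coheight a) Q
  have hT : IsWeaklyRegular (TensorProduct S T N) (rs.map (algebraMap S T)) :=
    hr.of_flat_of_isBaseChange (TensorProduct.isBaseChange S N T)
  have e1 : TensorProduct R S M ≃ₗ[S] N :=
    (IsLocalizedModule.isBaseChange p.primeCompl S (LocalizedModule.mkLinearMap p.primeCompl M)).equiv
  have e2 : TensorProduct R T M ≃ₗ[T] O :=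
    (IsLocalizedModule.isBaseChange q.primeCompl T (LocalizedModule.mkLinearMap q.primeCompl M)).equiv
  have e : TensorProduct S T N ≃ₗ[T] O :=
    (TensorProduct.AlgebraTensorModule.congr (LinearEquiv.refl T T) e1.symm).trans
      ((TensorProduct.AlgebraTensorModule.cancelBaseChange R S T T M).trans e2)
  have hO : IsWeaklyRegular O (rs.map (algebraMap S T)) := (e.isWeaklyRegular_congr _).mp hT
  refine le_sSup ⟨rs.map (algebraMap S T), ?_, hO, by simp [hl]⟩
  intro r hr
  obtain ⟨s, hs, rfl⟩ := List.mem_map.mp hr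
  exact hm s hs
end

section
/- Let R be a Cohen-Macaulay commutative Noetherian ring, p a prime ideal, and M a finitely generated R-module such that M_p is a maximal Cohen-Macaulay R_p-module (i.e., M_p = 0 or depth M_p = dim R_p). Then there exists s ∈ R \ p such that s·H^i_a(M) = 0 for all ideals a of R and all integers i < grade(a,R). -/
open CategoryTheory CategoryTheory.Abelian Pointwise

namespace S11

set_option linter.unusedSectionVars false

section ExtBasics

variable {R : Type} [CommRing R]

/-- `s` annihilates `Ext^i(N, M)`. -/
def Kill (s : R) (N : ModuleCat.{0} R) (M : Type) [AddCommGroup M] [Module R M] (i : ℕ) : Prop :=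
  ∀ x : Abelian.Ext.{0} N (ModuleCat.of R M) i, s • x = 0

variable {A B C : Type} [AddCommGroup A] [Module R A] [AddCommGroup B] [Module R B]
  [AddCommGroup C] [Module R C] {M : Type} [AddCommGroup M] [Module R M]
  {M' : Type} [AddCommGroup M'] [Module R M'] {N : ModuleCat.{0} R}

lemma Kill.mul_left {s : R} {i : ℕ} (h : Kill s N M i) (t : R) : Kill (t * s) N M i := by
  intro x; rw [mul_smul, h x, smul_zero]

lemma Kill.mul_right {s : R} {i : ℕ} (h : Kill s N M i) (t : R) : Kill (s * t) N M i := by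
  rw [mul_comm]; exact h.mul_left t

lemma Kill.add {s t : R} {i : ℕ} (h : Kill s N M i) (h' : Kill t N M i) :
    Kill (s + t) N M i := by
  intro x; rw [add_smul, h x, h' x, add_zero]

lemma Kill.zero {i : ℕ} : Kill (0 : R) N M i := by
  intro x; rw [zero_smul]

lemma Kill.of_smul {s : R} (h : ∀ m : M, s • m = 0) (i : ℕ) : Kill s N M i := by
  intro x
  rw [Ext.smul_eq_comp_mk₀]
  have : (s • 𝟙 (ModuleCat.of R M)) = 0 := by
    ext m
    exact h m
  rw [this]
  simp

lemma sexact {f : A →ₗ[R] B} {g : B →ₗ[R] C} (hf : Function.Injective f)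
    (hg : Function.Surjective g) (h : Function.Exact f g) :
    (ModuleCat.shortComplexOfCompEqZero f g h.linearMap_comp_eq_zero).ShortExact where
  exact := ModuleCat.shortComplex_exact _ h
  mono_f := by simpa [ModuleCat.mono_iff_injective] using hf
  epi_g := by simpa [ModuleCat.epi_iff_surjective] using hg

lemma kill_mid {f : A →ₗ[R] B} {g : B →ₗ[R] C} (hf : Function.Injective f)
    (hg : Function.Surjective g) (h : Function.Exact f g) {s t : R} {i : ℕ}
    (hs : Kill s N A i) (ht : Kill t N C i) : Kill (s * t) N B i := by
  intro x
  have hS := sexact hf hg h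
  obtain ⟨y, hy⟩ := Ext.covariant_sequence_exact₂ N hS (t • x) (by
    rw [Ext.smul_comp]; exact ht _)
  rw [mul_smul, ← hy, ← Ext.smul_comp]
  have : s • y = 0 := hs y
  rw [this, Ext.zero_comp]

lemma kill_left {f : A →ₗ[R] B} {g : B →ₗ[R] C} (hf : Function.Injective f)
    (hg : Function.Surjective g) (h : Function.Exact f g) {s t : R} {i : ℕ}
    (hs : Kill s N B (i + 1)) (ht : Kill t N C i) : Kill (t * s) N A (i + 1) := by
  intro x
  have hS := sexact hf hg h
  obtain ⟨y, hy⟩ := Ext.covariant_sequence_exact₁ N hS (s • x) (by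
    rw [Ext.smul_comp]; exact hs _) rfl
  rw [mul_smul, ← hy, ← Ext.smul_comp]
  have : t • y = 0 := ht y
  rw [this, Ext.zero_comp]

lemma kill_left_zero {f : A →ₗ[R] B} (hf : Function.Injective f) {s : R}
    (hs : Kill s N B 0) : Kill s N A 0 := by
  intro x
  have : Mono (ModuleCat.ofHom f) := by rwa [ModuleCat.mono_iff_injective]
  apply Ext.postcomp_mk₀_injective_of_mono N (ModuleCat.ofHom f)
  rw [map_zero]
  change (s • x).comp (Ext.mk₀ (ModuleCat.ofHom f)) (add_zero 0) = 0
  rw [Ext.smul_comp]; exact hs _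

lemma kill_right {f : A →ₗ[R] B} {g : B →ₗ[R] C} (hf : Function.Injective f)
    (hg : Function.Surjective g) (h : Function.Exact f g) {s t : R} {i : ℕ}
    (hs : Kill s N B i) (ht : Kill t N A (i + 1)) : Kill (s * t) N C i := by
  intro x
  have hS := sexact hf hg h
  obtain ⟨y, hy⟩ := Ext.covariant_sequence_exact₃ N hS (t • x) rfl (by
    rw [Ext.smul_comp]; exact ht _)
  rw [mul_smul, ← hy, ← Ext.smul_comp]
  have : s • y = 0 := hs y
  rw [this, Ext.zero_comp]

lemma Kill.equiv (e : M ≃ₗ[R] M') {s : R} {i : ℕ} (h : Kill s N M i) : Kill s N M' i := by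
  have := kill_mid (N := N) (f := e.toLinearMap) (g := (0 : M' →ₗ[R] PUnit)) e.injective
    (fun _ => ⟨0, rfl⟩) (fun x => ⟨fun _ => ⟨e.symm x, by simp⟩, fun _ => rfl⟩) h
    (Kill.of_smul (s := (1 : R)) (fun _ => rfl) i)
  simpa using this

/-- multiplication by `x` onto its image -/
def toSm (x : R) (M : Type) [AddCommGroup M] [Module R M] : M →ₗ[R] (x • (⊤ : Submodule R M) : Submodule R M) :=
  (LinearMap.lsmul R M x).codRestrict _ (fun m => Submodule.smul_mem_pointwise_smul m x ⊤ trivial)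

lemma toSm_surj (x : R) : Function.Surjective (toSm x M) := by
  rintro ⟨m, hm⟩
  obtain ⟨y, -, rfl⟩ := (Submodule.mem_smul_pointwise_iff_exists _ _ _).1 hm
  exact ⟨y, rfl⟩

lemma toSm_ker_smul {x s : R} (hK : ∀ m : M, x • m = 0 → s • m = 0)
    (m : LinearMap.ker (toSm x M)) : s • m = 0 := by
  ext
  apply hK
  exact congrArg Subtype.val m.2

lemma kill_torsion {x s r : R} (hK : ∀ m : M, x • m = 0 → s • m = 0) {i : ℕ}
    (hr : ∀ j, j + 1 = i → Kill r N (QuotSMulTop x M) j)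
    (z : Abelian.Ext.{0} N (ModuleCat.of R M) i) (hz : x • z = 0) : (s * r) • z = 0 := by
  have hS1 := sexact (LinearMap.ker (toSm x M)).injective_subtype (toSm_surj (M := M) x)
    (LinearMap.exact_subtype_ker_map _)
  have hS2 := sexact (x • (⊤ : Submodule R M)).injective_subtype
    (Submodule.mkQ_surjective _) (LinearMap.exact_subtype_mkQ (x • (⊤ : Submodule R M)))
  let z' := z.comp (Ext.mk₀ (ModuleCat.ofHom (toSm x M))) (add_zero i)
  have hz' : r • z' = 0 := by
    have h0 : z'.comp (Ext.mk₀ (ModuleCat.ofHom (x • (⊤ : Submodule R M)).subtype)) (add_zero i)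
        = 0 := by
      rw [← hz, Ext.smul_eq_comp_mk₀]
      simp only [z']
      rw [Ext.comp_assoc_of_second_deg_zero, Ext.mk₀_comp_mk₀]
      rfl
    rcases i with _ | j
    · have : Mono (ModuleCat.ofHom (x • (⊤ : Submodule R M)).subtype) := by
        rw [ModuleCat.mono_iff_injective]; exact Subtype.val_injective
      have : z' = 0 := by
        apply Ext.postcomp_mk₀_injective_of_mono N (ModuleCat.ofHom (x • (⊤ : Submodule R M)).subtype)
        rw [map_zero]; exact h0
      rw [this, smul_zero]
    · obtain ⟨w, hw⟩ := Ext.covariant_sequence_exact₁ N hS2 z' h0 rfl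
      rw [← hw, ← Ext.smul_comp]
      have : r • w = 0 := hr j rfl w
      rw [this, Ext.zero_comp]
  obtain ⟨w, hw⟩ := Ext.covariant_sequence_exact₂ N hS1 (r • z) (by
    rw [Ext.smul_comp]; exact hz')
  rw [mul_smul, ← hw, ← Ext.smul_comp]
  have : s • w = 0 := Kill.of_smul (toSm_ker_smul hK) i w
  rw [this, Ext.zero_comp]

lemma kill_quot {x s r r' : R} (hK : ∀ m : M, x • m = 0 → s • m = 0) {i : ℕ}
    (hr : Kill r N M i) (hr' : Kill r' N M (i + 1)) :
    Kill (r * (r' * s)) N (QuotSMulTop x M) i := by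
  refine kill_right (x • (⊤ : Submodule R M)).injective_subtype
    (Submodule.mkQ_surjective _) (LinearMap.exact_subtype_mkQ (x • (⊤ : Submodule R M))) hr ?_
  exact kill_right (LinearMap.ker (toSm x M)).injective_subtype (toSm_surj (M := M) x)
    (LinearMap.exact_subtype_ker_map _) hr' (Kill.of_smul (toSm_ker_smul hK) _)

/-- `Ext^i(N, R) = 0` for `i < g`. -/
def Van (N : ModuleCat.{0} R) (g : ℕ) : Prop := ∀ i < g, Kill (1 : R) N R i

/-- The ideal of elements which kill `Ext^i(N, M)` whenever `i + c < g` and `grade N ≥ g`. -/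
def J (R : Type) [CommRing R] (c : ℕ) (M : Type) [AddCommGroup M] [Module R M] : Ideal R where
  carrier := {s | ∀ (N : ModuleCat.{0} R) (g i : ℕ), Van N g → i + c < g → Kill s N M i}
  add_mem' h h' N g i hg hi := (h N g i hg hi).add (h' N g i hg hi)
  zero_mem' _ _ _ _ _ := Kill.zero
  smul_mem' t _ h N g i hg hi := (h N g i hg hi).mul_left t

lemma J_mono {c c' : ℕ} (h : c ≤ c') : J R c M ≤ J R c' M :=
  fun _ hs N g i hg hi => hs N g i hg (by omega)

lemma J_mid {f : A →ₗ[R] B} {g : B →ₗ[R] C} (hf : Function.Injective f)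
    (hg : Function.Surjective g) (h : Function.Exact f g) {s t : R} {c : ℕ}
    (hs : s ∈ J R c A) (ht : t ∈ J R c C) : s * t ∈ J R c B :=
  fun N _ i hv hi => kill_mid hf hg h (hs N _ i hv hi) (ht N _ i hv hi)

lemma J_left {f : A →ₗ[R] B} {g : B →ₗ[R] C} (hf : Function.Injective f)
    (hg : Function.Surjective g) (h : Function.Exact f g) {s t : R} {c : ℕ}
    (hs : s ∈ J R c B) (ht : t ∈ J R (c + 1) C) : t * s ∈ J R c A := by
  intro N _ i hv hi
  rcases i with _ | i
  · exact (kill_left_zero hf (hs N _ 0 hv hi)).mul_left t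
  · exact kill_left hf hg h (hs N _ _ hv hi) (ht N _ i hv (by omega))

lemma J_smul {s : R} (h : ∀ m : M, s • m = 0) (c : ℕ) : s ∈ J R c M :=
  fun _ _ i _ _ => Kill.of_smul h i

lemma J_one : (1 : R) ∈ J R 0 R := fun _ _ i hv hi => hv i hi

lemma J_equiv (e : M ≃ₗ[R] M') {s : R} {c : ℕ} (h : s ∈ J R c M) : s ∈ J R c M' :=
  fun N _ i hv hi => (h N _ i hv hi).equiv e

lemma J_quot {x s r : R} (hK : ∀ m : M, x • m = 0 → s • m = 0) {c : ℕ} (hr : r ∈ J R c M) :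
    r * (r * s) ∈ J R (c + 1) (QuotSMulTop x M) :=
  fun N _ i hv hi => kill_quot hK (hr N _ i hv (by omega)) (hr N _ _ hv (by omega))

end ExtBasics

end S11


open CategoryTheory CategoryTheory.Abelian Pointwise

namespace S11

set_option linter.unusedSectionVars false

section LeftVar

variable {R : Type} [CommRing R]
variable {A B C : Type} [AddCommGroup A] [Module R A] [AddCommGroup B] [Module R B]
  [AddCommGroup C] [Module R C] {M : Type} [AddCommGroup M] [Module R M]

lemma Kill.of_smul_left {N : Type} [AddCommGroup N] [Module R N] {s : R}
    (h : ∀ n : N, s • n = 0) (i : ℕ) : Kill s (ModuleCat.of R N) M i := by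
  intro x
  have h1 : (Ext.mk₀ (𝟙 (ModuleCat.of R N))).comp x (zero_add i) = x := by simp
  have : (s • 𝟙 (ModuleCat.of R N)) = 0 := by
    ext m
    exact h m
  rw [← h1, ← Ext.smul_comp, ← Ext.mk₀_smul, this]
  simp

lemma kill_mid' {f : A →ₗ[R] B} {g : B →ₗ[R] C} (hf : Function.Injective f)
    (hg : Function.Surjective g) (h : Function.Exact f g) {s t : R} {i : ℕ}
    (hs : Kill s (ModuleCat.of R A) M i) (ht : Kill t (ModuleCat.of R C) M i) :
    Kill (s * t) (ModuleCat.of R B) M i := by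
  intro x
  have hS := sexact hf hg h
  obtain ⟨y, hy⟩ := Ext.contravariant_sequence_exact₂ hS (ModuleCat.of R M) (s • x) (by
    rw [Ext.comp_smul]; exact hs _)
  rw [mul_comm, mul_smul, ← hy, ← Ext.comp_smul]
  have : t • y = 0 := ht y
  rw [this, Ext.comp_zero]

lemma Kill.equiv' (e : A ≃ₗ[R] B) {s : R} {i : ℕ} (h : Kill s (ModuleCat.of R A) M i) :
    Kill s (ModuleCat.of R B) M i := by
  have := kill_mid' (M := M) (f := e.toLinearMap) (g := (0 : B →ₗ[R] PUnit)) e.injective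
    (fun _ => ⟨0, rfl⟩) (fun x => ⟨fun _ => ⟨e.symm x, by simp⟩, fun _ => rfl⟩) h
    (Kill.of_smul_left (s := (1 : R)) (fun _ => rfl) i)
  simpa using this

end LeftVar

section F

variable {R : Type} [CommRing R] [IsNoetherianRing R]

lemma notMem_mul {q : Ideal R} (hq : q.IsPrime) {a b : R} (ha : a ∉ q) (hb : b ∉ q) : a * b ∉ q :=
  fun h => (hq.mem_or_mem h).elim ha hb

lemma notMem_pow {q : Ideal R} (hq : q.IsPrime) {a : R} (ha : a ∉ q) (n : ℕ) : a ^ n ∉ q :=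
  fun h => ha (hq.mem_of_pow_mem n h)

lemma smul_quot_zero {I : Ideal R} {x : R} (hx : x ∈ I) (m : R ⧸ I) : x • m = 0 := by
  obtain ⟨m, rfl⟩ := Ideal.Quotient.mk_surjective m
  rw [← Ideal.Quotient.mk_eq_mk, ← Submodule.Quotient.mk_smul, Submodule.Quotient.mk_eq_zero]
  exact I.mul_mem_right m hx

lemma mem_support_quot {q : PrimeSpectrum R} : q ∈ Module.support R (R ⧸ q.asIdeal) := by
  rw [Module.mem_support_iff_of_finite, Ideal.annihilator_quotient]

/-- all primes of the support of `M` contained in `q` equal `q`. -/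
def Conc (q : Ideal R) (M : Type) [AddCommGroup M] [Module R M] : Prop :=
  ∀ Q ∈ Module.support R M, Q.asIdeal ≤ q → Q.asIdeal = q

lemma F_lemma {q : Ideal R} (hq : q.IsPrime) (M : Type) [AddCommGroup M] [Module R M]
    [hM : Module.Finite R M] (hc : Conc q M) :
    ∃ n : ℕ, ∃ t ∉ q, ∀ (N : ModuleCat.{0} R) (i : ℕ) (r : R), Kill r N (R ⧸ q) i →
      Kill (r ^ n * t) N M i := by
  revert hc
  induction hM using IsNoetherianRing.induction_on_isQuotientEquivQuotientPrime R with
  | subsingleton N =>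
    exact fun _ => ⟨0, 1, hq.one_notMem, fun _ i _ _ => Kill.of_smul (fun m => Subsingleton.elim _ _) i⟩
  | quotient N p e =>
    intro hc
    by_cases hpq : p.1 ≤ q
    · have : p.asIdeal = q := hc p (by rw [e.support_eq]; exact mem_support_quot) hpq
      subst this
      exact ⟨1, 1, hq.one_notMem, fun N i r hr => by simpa using hr.equiv e.symm⟩
    · obtain ⟨t, ht, htq⟩ := SetLike.not_le_iff_exists.1 hpq
      refine ⟨0, t, htq, fun _ i _ _ => (Kill.mul_left (Kill.of_smul (fun m => ?_) i) _)⟩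
      apply e.injective
      rw [map_smul, smul_quot_zero ht, map_zero]
  | exact N₁ N₂ N₃ f g hf hg h ih₁ ih₃ =>
    intro hc
    obtain ⟨n₁, t₁, h₁, H₁⟩ := ih₁ (fun Q hQ => hc Q (Module.support_subset_of_injective f hf hQ))
    obtain ⟨n₃, t₃, h₃, H₃⟩ := ih₃ (fun Q hQ => hc Q (Module.support_subset_of_surjective g hg hQ))
    refine ⟨n₁ + n₃, t₁ * t₃, notMem_mul hq h₁ h₃, fun N i r hr => ?_⟩
    have := kill_mid hf hg h (H₁ N i r hr) (H₃ N i r hr)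
    convert this using 1
    ring

lemma F_lemma' {q : Ideal R} (hq : q.IsPrime) (W : Type) [AddCommGroup W] [Module R W]
    [hW : Module.Finite R W] (hc : Conc q W) (M : Type) [AddCommGroup M] [Module R M] (i : ℕ)
    (hk : ∃ s ∉ q, Kill s (ModuleCat.of R (R ⧸ q)) M i) :
    ∃ t ∉ q, Kill t (ModuleCat.of R W) M i := by
  revert hc
  induction hW using IsNoetherianRing.induction_on_isQuotientEquivQuotientPrime R with
  | subsingleton N =>
    exact fun _ => ⟨1, hq.one_notMem, Kill.of_smul_left (fun m => Subsingleton.elim _ _) i⟩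
  | quotient N p e =>
    intro hc
    by_cases hpq : p.1 ≤ q
    · have : p.asIdeal = q := hc p (by rw [e.support_eq]; exact mem_support_quot) hpq
      subst this
      obtain ⟨s, hs, h⟩ := hk
      exact ⟨s, hs, h.equiv' e.symm⟩
    · obtain ⟨t, ht, htq⟩ := SetLike.not_le_iff_exists.1 hpq
      refine ⟨t, htq, Kill.of_smul_left (fun m => ?_) i⟩
      apply e.injective
      rw [map_smul, smul_quot_zero ht, map_zero]
  | exact N₁ N₂ N₃ f g hf hg h ih₁ ih₃ =>
    intro hc
    obtain ⟨t₁, h₁, H₁⟩ := ih₁ (fun Q hQ => hc Q (Module.support_subset_of_injective f hf hQ))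
    obtain ⟨t₃, h₃, H₃⟩ := ih₃ (fun Q hQ => hc Q (Module.support_subset_of_surjective g hg hQ))
    exact ⟨t₁ * t₃, notMem_mul hq h₁ h₃, kill_mid' hf hg h H₁ H₃⟩

end F

end S11


open CategoryTheory CategoryTheory.Abelian Pointwise

namespace S11

set_option linter.unusedSectionVars false

section Reg

variable {R : Type} [CommRing R] [IsNoetherianRing R]

/-- `M`-regularity, locally at `p`. -/
def RegAt (p : Ideal R) : List R → (M : Type) → [AddCommGroup M] → [Module R M] → Prop
  | [], _, _, _ => True
  | x :: xs, M, _, _ => x ∈ p ∧ (∃ s ∉ p, ∀ m : M, x • m = 0 → s • m = 0) ∧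
      RegAt p xs (QuotSMulTop x M)

lemma exists_single {p : Ideal R} (hp : p.IsPrime) (M : Type) [AddCommGroup M] [Module R M]
    [Module.Finite R M] (h : ∀ m : M, ∃ r ∉ p, r • m = 0) : ∃ s ∉ p, ∀ m : M, s • m = 0 := by
  have h1 : (⟨p, hp⟩ : PrimeSpectrum R) ∉ Module.support R M := Module.notMem_support_iff'.2 h
  rw [Module.mem_support_iff_of_finite] at h1
  obtain ⟨s, hs, hsp⟩ := SetLike.not_le_iff_exists.1 h1
  exact ⟨s, hsp, Module.mem_annihilator.1 hs⟩

lemma exists_single' {p : Ideal R} (hp : p.IsPrime) (M : Type) [AddCommGroup M] [Module R M]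
    [Module.Finite R M] {x : R} (h : ∀ m : M, x • m = 0 → ∃ r ∉ p, r • m = 0) :
    ∃ s ∉ p, ∀ m : M, x • m = 0 → s • m = 0 := by
  obtain ⟨s, hs, H⟩ := exists_single hp (LinearMap.ker (LinearMap.lsmul R M x)) (by
    rintro ⟨m, hm⟩
    obtain ⟨r, hr, hrm⟩ := h m (by simpa using hm)
    exact ⟨r, hr, by ext; simpa using hrm⟩)
  refine ⟨s, hs, fun m hm => ?_⟩
  have := H ⟨m, by simpa using hm⟩
  exact congrArg Subtype.val this

lemma regAt_of_localized (p : Ideal R) [hp : p.IsPrime] (S : Type) [CommRing S] [Algebra R S]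
    [IsLocalization p.primeCompl S] (rs : List S) :
    ∀ (M : Type) [AddCommGroup M] [Module R M] [Module.Finite R M]
    (M' : Type) [AddCommGroup M'] [Module R M'] [Module S M'] [IsScalarTower R S M']
    (f : M →ₗ[R] M') [IsLocalizedModule p.primeCompl f],
    (∀ r ∈ rs, ¬ IsUnit r) → RingTheory.Sequence.IsWeaklyRegular M' rs →
    ∃ xs : List R, RegAt p xs M ∧ xs.length = rs.length := by
  induction rs with
  | nil => intros; exact ⟨[], trivial, rfl⟩
  | cons r rs ih =>
    intro M _ _ _ M' _ _ _ _ f _ hmem hreg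
    rw [RingTheory.Sequence.isWeaklyRegular_cons_iff] at hreg
    obtain ⟨hr, hrs⟩ := hreg
    obtain ⟨x, u, rfl⟩ := IsLocalization.exists_mk'_eq p.primeCompl r
    have heq : (x • (⊤ : Submodule R M)).localized' S p.primeCompl f =
        (IsLocalization.mk' S x u) • (⊤ : Submodule S M') := by
      ext y
      rw [Submodule.mem_localized', Submodule.mem_smul_pointwise_iff_exists]
      constructor
      · rintro ⟨m, hm, s, rfl⟩
        obtain ⟨m, -, rfl⟩ := (Submodule.mem_smul_pointwise_iff_exists _ _ _).1 hm
        refine ⟨IsLocalizedModule.mk' f (u • m) s, trivial, ?_⟩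
        rw [IsLocalizedModule.mk'_smul_mk', IsLocalizedModule.mk'_eq_mk'_iff]
        refine ⟨1, ?_⟩
        simp only [one_smul, Submonoid.smul_def, Submonoid.coe_mul, smul_smul]
        congr 1; ring
      · rintro ⟨y, -, rfl⟩
        obtain ⟨⟨m, s⟩, rfl⟩ := IsLocalizedModule.mk'_surjective p.primeCompl f y
        refine ⟨x • m, Submodule.smul_mem_pointwise_smul m x ⊤ trivial, u * s, ?_⟩
        simp only [Function.uncurry_apply_pair]
        rw [IsLocalizedModule.mk'_smul_mk']
    have hrs' : RingTheory.Sequence.IsWeaklyRegular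
        (M' ⧸ (x • (⊤ : Submodule R M)).localized' S p.primeCompl f) rs := by
      rw [heq]; exact hrs
    obtain ⟨xs, hxs, hlen⟩ := ih (QuotSMulTop x M) _
      ((x • (⊤ : Submodule R M)).toLocalizedQuotient' S p.primeCompl f)
      (fun r hr => hmem r (List.mem_cons_of_mem _ hr)) hrs'
    refine ⟨x :: xs, ⟨?_, ?_, hxs⟩, by simp [hlen]⟩
    · by_contra hx
      apply hmem _ List.mem_cons_self
      have hx' : x ∈ p.primeCompl := hx
      exact IsUnit.of_mul_eq_one _ (IsLocalization.mk'_mul_mk'_eq_one (⟨x, hx'⟩ : p.primeCompl) u)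
    · apply exists_single' hp
      intro m hm
      have h0 : f m = 0 := by
        apply hr
        simp only [smul_zero]
        have : IsLocalization.mk' S x u = IsLocalization.mk' S 1 u * algebraMap R S x := by
          rw [IsLocalization.mk'_eq_mul_mk'_one, mul_comm]
        rw [this, mul_smul, algebraMap_smul, ← map_smul, hm, map_zero, smul_zero]
      obtain ⟨c, hc⟩ := (IsLocalizedModule.eq_zero_iff p.primeCompl f).1 h0
      exact ⟨c, c.2, hc⟩

lemma regAt_of_seqDepth (p : Ideal R) [hp : p.IsPrime] (M : Type) [AddCommGroup M] [Module R M]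
    [Module.Finite R M]
    (M' : Type) [AddCommGroup M'] [Module R M'] [Module (Localization.AtPrime p) M']
    [IsScalarTower R (Localization.AtPrime p) M']
    (f : M →ₗ[R] M') [IsLocalizedModule p.primeCompl f]
    (h : ((seqDepth (IsLocalRing.maximalIdeal (Localization.AtPrime p)) M' : ℕ∞) : WithBot ℕ∞) =
      ringKrullDim (Localization.AtPrime p)) :
    ∃ xs : List R, RegAt p xs M ∧ (xs.length : ℕ∞) = p.height := by
  rw [IsLocalization.AtPrime.ringKrullDim_eq_height p] at h
  have h' : seqDepth (IsLocalRing.maximalIdeal (Localization.AtPrime p)) M' = p.height :=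
    WithBot.coe_injective h
  have hfin : p.height ≠ ⊤ := Ideal.height_ne_top hp.ne_top
  obtain ⟨d, hd⟩ := ENat.ne_top_iff_exists.1 hfin
  rw [← hd] at h' ⊢
  have : ∃ rs : List (Localization.AtPrime p), (∀ r ∈ rs, ¬ IsUnit r) ∧
      RingTheory.Sequence.IsWeaklyRegular M' rs ∧ rs.length = d := by
    unfold seqDepth at h'
    have : Nonempty {n : ℕ∞ | ∃ rs : List (Localization.AtPrime p),
        (∀ r ∈ rs, r ∈ (IsLocalRing.maximalIdeal (Localization.AtPrime p))) ∧
        RingTheory.Sequence.IsWeaklyRegular M' rs ∧ rs.length = n} :=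
      ⟨0, [], by simp, RingTheory.Sequence.IsWeaklyRegular.nil _ _, rfl⟩
    have hmem := ENat.sSup_mem_of_nonempty_of_lt_top
      (s := {n : ℕ∞ | ∃ rs : List (Localization.AtPrime p),
        (∀ r ∈ rs, r ∈ (IsLocalRing.maximalIdeal (Localization.AtPrime p))) ∧
    RingTheory.Sequence.IsWeaklyRegular M' rs ∧ rs.length = n})
      (by rw [h']; simp)
    rw [h'] at hmem
    obtain ⟨rs, h1, h2, h3⟩ := hmem
    exact ⟨rs, h1, h2, by exact_mod_cast h3⟩
  obtain ⟨rs, h1, h2, h3⟩ := this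
  obtain ⟨xs, hxs, hl⟩ := regAt_of_localized p (Localization.AtPrime p) rs M M' f h1 h2
  exact ⟨xs, hxs, by rw [hl, h3]⟩

end Reg

end S11


open CategoryTheory CategoryTheory.Abelian Pointwise

namespace S11

set_option linter.unusedSectionVars false

section B

variable {R : Type} [CommRing R] [IsNoetherianRing R]

lemma mem_ass_of_conc (Q : PrimeSpectrum R) (M : Type) [AddCommGroup M] [Module R M]
    [Module.Finite R M] (hQ : Q ∈ Module.support R M) (hc : Conc Q.asIdeal M) :
    Q.asIdeal ∈ associatedPrimes R M := by
  apply Module.associatedPrimes.minimalPrimes_annihilator_subset_associatedPrimes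
  rw [Module.mem_support_iff_of_finite] at hQ
  obtain ⟨P, hP, hPQ⟩ := Ideal.exists_minimalPrimes_le hQ
  have hPp : P.IsPrime := hP.1.1
  have := hc ⟨P, hPp⟩ (Module.mem_support_iff_of_finite.2 hP.1.2) hPQ
  simp only at this
  rwa [this] at hP

lemma exists_lt_support {p : Ideal R} {M : Type} [AddCommGroup M] [Module R M]
    [Module.Finite R M] {x : R} (hs : ∃ s ∉ p, ∀ m : M, x • m = 0 → s • m = 0)
    (Q : PrimeSpectrum R) (hQ : Q ∈ Module.support R (QuotSMulTop x M)) (hQp : Q.asIdeal ≤ p) :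
    ∃ Q' ∈ Module.support R M, Q'.asIdeal < Q.asIdeal := by
  rw [Module.support_quotSMulTop] at hQ
  by_contra! hcon
  obtain ⟨s, hsp, hs⟩ := hs
  have h := mem_ass_of_conc Q M hQ.1 (fun Q' hQ' hle => by
    by_contra hne
    exact hcon Q' hQ' (lt_of_le_of_ne hle hne))
  obtain ⟨m, hm⟩ := ((isAssociatedPrime_iff (I := Q.asIdeal)).1 h).2
  have hx : x ∈ Q.asIdeal := by simpa using hQ.2
  rw [hm] at hx
  apply hsp
  apply hQp
  rw [hm]
  simp only [Submodule.mem_colon_singleton, Submodule.mem_bot] at hx ⊢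
  exact hs m hx

lemma regAt_quot (p : PrimeSpectrum R) (xs : List R) : ∀ (M : Type) [AddCommGroup M] [Module R M]
    [Module.Finite R M] (c : ℕ) (r : R), RegAt p.asIdeal xs M → p ∈ Module.support R M →
    r ∉ p.asIdeal → r ∈ J R c M →
    ∃ B : ModuleCat.{0} R, Module.Finite R B ∧ p ∈ Module.support R B ∧
      (∃ r' ∉ p.asIdeal, r' ∈ J R (c + xs.length) B) ∧
      ∀ Q ∈ Module.support R B, Q.asIdeal ≤ p.asIdeal → (xs.length : ℕ∞) ≤ Q.asIdeal.height := by
  suffices H : ∀ (M : Type) [AddCommGroup M] [Module R M]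
    [Module.Finite R M] (c : ℕ) (r : R), RegAt p.asIdeal xs M → p ∈ Module.support R M →
    r ∉ p.asIdeal → r ∈ J R c M →
    ∃ B : ModuleCat.{0} R, Module.Finite R B ∧ p ∈ Module.support R B ∧
      (∃ r' ∉ p.asIdeal, r' ∈ J R (c + xs.length) B) ∧
      ∀ Q ∈ Module.support R B, Q.asIdeal ≤ p.asIdeal → ∃ Q' ∈ Module.support R M,
        Q'.asIdeal ≤ p.asIdeal ∧ Q'.asIdeal.height + (xs.length : ℕ∞) ≤ Q.asIdeal.height by
    intro M _ _ _ c r h1 h2 h3 h4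
    obtain ⟨B, b1, b2, b3, b4⟩ := H M c r h1 h2 h3 h4
    refine ⟨B, b1, b2, b3, fun Q hQ hQp => ?_⟩
    obtain ⟨Q', _, _, h⟩ := b4 Q hQ hQp
    exact le_trans le_add_self h
  induction xs with
  | nil =>
    intro M _ _ _ c r h1 h2 h3 h4
    exact ⟨ModuleCat.of R M, ‹_›, h2, ⟨r, h3, h4⟩, fun Q hQ hQp => ⟨Q, hQ, hQp, by simp⟩⟩
  | cons x xs ih =>
    intro M _ _ _ c r h1 h2 h3 h4
    obtain ⟨hx, hs, hxs⟩ := h1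
    obtain ⟨s, hsp, hK⟩ := id hs
    obtain ⟨B, b1, b2, ⟨r', b3, b3'⟩, b4⟩ := ih (QuotSMulTop x M) (c + 1) (r * (r * s)) hxs (by
        rw [Module.support_quotSMulTop]
        exact ⟨h2, by simpa using hx⟩)
      (notMem_mul p.2 h3 (notMem_mul p.2 h3 hsp)) (J_quot hK h4)
    refine ⟨B, b1, b2, ⟨r', b3, ?_⟩, fun Q hQ hQp => ?_⟩
    · rw [List.length_cons, show c + (xs.length + 1) = c + 1 + xs.length by ring]
      exact b3'
    · obtain ⟨Q1, hQ1, hQ1p, hle⟩ := b4 Q hQ hQp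
      obtain ⟨Q', hQ', hlt⟩ := exists_lt_support hs Q1 hQ1 hQ1p
      refine ⟨Q', hQ', hlt.le.trans hQ1p, le_trans ?_ hle⟩
      have := Ideal.height_add_one_le_of_lt_of_isPrime hlt
      rw [List.length_cons, Nat.cast_add, Nat.cast_one, add_comm (xs.length : ℕ∞), ← add_assoc]
      gcongr

/-- the key auxiliary modules: `0 → R/q → B → C → 0`. -/
lemma exists_B (hCM : IsCohenMacaulayRing R) (q : Ideal R) (hq : q.IsPrime) {d : ℕ}
    (hd : q.height = d) :
    ∃ (B C : ModuleCat.{0} R) (f : (R ⧸ q) →ₗ[R] B) (g : B →ₗ[R] C),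
      Module.Finite R C ∧ Function.Injective f ∧ Function.Surjective g ∧ Function.Exact f g ∧
      (∃ s ∉ q, s ∈ J R d B) ∧
      ∃ n : ℕ, ∃ t ∉ q, ∀ (N : ModuleCat.{0} R) (i : ℕ) (r : R), Kill r N (R ⧸ q) i →
        Kill (r ^ n * t) N C i := by
  have h1 := hCM q hq
  obtain ⟨xs, hxs, hlen⟩ := regAt_of_seqDepth q R (Localization.AtPrime q)
    (Algebra.linearMap R (Localization.AtPrime q)) h1
  have hlen' : xs.length = d := by rw [hd] at hlen; exact_mod_cast hlen
  obtain ⟨B, b1, b2, ⟨s, hs, hs'⟩, b4⟩ := regAt_quot ⟨q, hq⟩ xs R 0 1 hxs (by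
    rw [Module.mem_support_iff']
    refine ⟨1, fun r hr h => hr ?_⟩
    have : r = 0 := by simpa using h
    rw [this]; exact q.zero_mem) hq.one_notMem J_one
  have hconc : Conc q B := by
    intro Q hQ hQq
    by_contra hne
    have h2 := b4 Q hQ hQq
    have h3 := Ideal.height_add_one_le_of_lt_of_isPrime (lt_of_le_of_ne hQq hne)
    rw [hd] at h3
    rw [hlen'] at h2
    have h4 : (d : ℕ∞) + 1 ≤ d := le_trans (by gcongr) h3
    norm_cast at h4
    omega
  have hass := mem_ass_of_conc ⟨q, hq⟩ B b2 hconc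
  obtain ⟨_, f, hf⟩ := (isAssociatedPrime_iff_exists_injective_linearMap _ _).1 hass
  refine ⟨B, ModuleCat.of R (B ⧸ LinearMap.range f), f, (LinearMap.range f).mkQ,
    inferInstanceAs (Module.Finite R (B ⧸ LinearMap.range f)), hf,
    Submodule.mkQ_surjective _, LinearMap.exact_map_mkQ_range f, ⟨s, hs, ?_⟩, ?_⟩
  · rwa [hlen', zero_add] at hs'
  · have : Module.Finite R (B ⧸ LinearMap.range f) := inferInstance
    exact F_lemma hq (B ⧸ LinearMap.range f) (fun Q hQ => hconc Q
      (Module.support_subset_of_surjective _ (Submodule.mkQ_surjective (LinearMap.range f)) hQ))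

end B

end S11


open CategoryTheory CategoryTheory.Abelian Pointwise

namespace S11

set_option linter.unusedSectionVars false

section Bounded

variable {R : Type} [CommRing R] [IsNoetherianRing R]

lemma torsion_pow {M : Type} [AddCommGroup M] [Module R M] {N : ModuleCat.{0} R}
    {x s r : R} (hK : ∀ m : M, x • m = 0 → s • m = 0) {i : ℕ}
    (hr : ∀ j, j + 1 = i → Kill r N (QuotSMulTop x M) j) (n : ℕ) :
    ∀ (z : Abelian.Ext.{0} N (ModuleCat.of R M) i), x ^ n • z = 0 → (s * r) ^ n • z = 0 := by
  induction n with
  | zero => intro z hz; simpa using hz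
  | succ n ih =>
    intro z hz
    have h1 := kill_torsion hK hr (x ^ n • z) (by rw [smul_smul, ← pow_succ', hz])
    rw [smul_comm] at h1
    have h2 := ih _ h1
    rwa [smul_smul, ← pow_succ] at h2

lemma notMem_smul_inj {q : Ideal R} (hq : q.IsPrime) {t : R} (ht : t ∉ q) (m : R ⧸ q)
    (h : t • m = 0) : m = 0 := by
  obtain ⟨m, rfl⟩ := Ideal.Quotient.mk_surjective m
  rw [← Ideal.Quotient.mk_eq_mk, ← Submodule.Quotient.mk_smul, Submodule.Quotient.mk_eq_zero] at h
  rw [← Ideal.Quotient.mk_eq_mk, Submodule.Quotient.mk_eq_zero]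
  exact (hq.mem_or_mem h).resolve_left ht

lemma exists_height (q : Ideal R) (hq : q.IsPrime) : ∃ d : ℕ, q.height = d := by
  have hfin : q.height ≠ ⊤ := Ideal.height_ne_top hq.ne_top
  obtain ⟨d, hd⟩ := ENat.ne_top_iff_exists.1 hfin
  exact ⟨d, hd.symm⟩

lemma bounded_prime (hCM : IsCohenMacaulayRing R) (q : Ideal R) (hq : q.IsPrime)
    (H : ∀ t ∉ q, ∃ k, (1 : R) ∈ J R k (QuotSMulTop t (R ⧸ q))) :
    ∃ k, (1 : R) ∈ J R k (R ⧸ q) := by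
  obtain ⟨d, hd⟩ := exists_height q hq
  obtain ⟨B, C, f, g, -, hf, hg, hfg, ⟨s, hs, hsJ⟩, n, t', ht', hF⟩ := exists_B hCM q hq hd
  obtain ⟨k, hk⟩ := H (s * t') (notMem_mul hq hs ht')
  have key : ∀ i : ℕ, ∃ m : ℕ, ∀ (N : ModuleCat.{0} R) (g : ℕ), Van N g → i + d < g →
      Kill ((s * t') ^ m) N (R ⧸ q) i := by
    intro i
    induction i with
    | zero =>
      refine ⟨1, fun N g hv hi => ?_⟩
      rw [pow_one]
      exact (kill_left_zero hf (hsJ N g 0 hv hi)).mul_right t'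
    | succ i ih =>
      obtain ⟨m, hm⟩ := ih
      refine ⟨m * n + 1, fun N g' hv hi => ?_⟩
      have := kill_left hf hg hfg (hsJ N g' (i + 1) hv hi)
        (hF N i _ (hm N g' hv (by omega)))
      convert this using 1
      rw [pow_succ, pow_mul]; ring
  refine ⟨max d k, fun N g i hv hi => ?_⟩
  have hd' := le_max_left d k
  have hk' := le_max_right d k
  obtain ⟨m, hm⟩ := key i
  intro z
  have := torsion_pow (M := R ⧸ q) (x := s * t') (s := 1) (r := 1) (N := N) (i := i) (fun m hm => by
    rw [one_smul]; exact notMem_smul_inj hq (notMem_mul hq hs ht') m hm)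
    (fun j hj => hk N g j hv (by omega)) m z (hm N g hv (by omega) z)
  simpa using this

lemma bounded (hCM : IsCohenMacaulayRing R) (M : Type) [AddCommGroup M] [Module R M]
    [Module.Finite R M] : ∃ k, (1 : R) ∈ J R k M := by
  suffices H : ∀ I : Ideal R, ∀ (M : Type) [AddCommGroup M] [Module R M]
    [Module.Finite R M], (∀ r ∈ I, ∀ m : M, r • m = 0) → ∃ k, (1 : R) ∈ J R k M from
    H ⊥ M (fun r hr m => by rw [Ideal.mem_bot.1 hr, zero_smul])
  intro I
  induction I using IsNoetherian.induction with
  | _ I IH =>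
  intro M _ _ hM
  induction hM using IsNoetherianRing.induction_on_isQuotientEquivQuotientPrime R with
  | subsingleton N => exact fun _ => ⟨0, J_smul (fun m => Subsingleton.elim _ _) 0⟩
  | quotient N p e =>
    intro hI
    obtain ⟨k, hk⟩ := bounded_prime hCM p.1 p.2 (fun t ht => by
      refine IH (p.1 ⊔ Ideal.span {t}) ?_ (QuotSMulTop t (R ⧸ p.1)) ?_
      · have h1 : I ≤ p.1 := by
          intro r hr
          have := hI r hr (e.symm (Ideal.Quotient.mk p.1 1))
          rw [← map_smul, LinearEquiv.map_eq_zero_iff] at this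
          rw [← Ideal.Quotient.mk_eq_mk, ← Submodule.Quotient.mk_smul,
            Submodule.Quotient.mk_eq_zero] at this
          simpa using this
        refine lt_of_le_of_lt h1 (lt_of_le_of_ne le_sup_left (fun h => ht ?_))
        rw [h]
        exact Ideal.mem_sup_right (Ideal.mem_span_singleton_self t)
      · suffices h : p.1 ⊔ Ideal.span {t} ≤ Module.annihilator R (QuotSMulTop t (R ⧸ p.1)) from
          fun r hr => Module.mem_annihilator.1 (h hr)
        apply sup_le
        · intro r hr
          rw [Module.mem_annihilator]
          intro m
          obtain ⟨m, rfl⟩ := Submodule.Quotient.mk_surjective _ m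
          rw [← Submodule.Quotient.mk_smul, smul_quot_zero hr, Submodule.Quotient.mk_zero]
        · rw [Ideal.span_singleton_le_iff_mem]
          exact QuotSMulTop.mem_annihilator _ t)
    exact ⟨k, J_equiv e.symm hk⟩
  | exact N₁ N₂ N₃ f g hf hg h ih₁ ih₃ =>
    intro hI
    obtain ⟨k₁, h₁⟩ := ih₁ (fun r hr m => hf (by rw [map_smul, hI r hr, map_zero]))
    obtain ⟨k₃, h₃⟩ := ih₃ (fun r hr m => by
      obtain ⟨m, rfl⟩ := hg m
      rw [← map_smul, hI r hr, map_zero])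
    refine ⟨max k₁ k₃, ?_⟩
    have := J_mid hf hg h (J_mono (le_max_left k₁ k₃) h₁) (J_mono (le_max_right k₁ k₃) h₃)
    simpa using this

lemma J_self (hCM : IsCohenMacaulayRing R) (q : Ideal R) (hq : q.IsPrime) {d : ℕ}
    (hd : q.height = d) : ∃ s ∉ q, s ∈ J R d (R ⧸ q) := by
  obtain ⟨B, C, f, g, -, hf, hg, hfg, ⟨s, hs, hsJ⟩, n, t, ht, hF⟩ := exists_B hCM q hq hd
  obtain ⟨k, hk⟩ := bounded hCM (R ⧸ q)
  suffices H : ∀ j, (∃ s ∉ q, s ∈ J R (d + j) (R ⧸ q)) → ∃ s ∉ q, s ∈ J R d (R ⧸ q) from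
    H k ⟨1, hq.one_notMem, J_mono (by omega) hk⟩
  intro j
  induction j with
  | zero => exact id
  | succ j ih =>
    rintro ⟨r, hr, hrJ⟩
    refine ih ⟨r ^ n * t * s, notMem_mul hq (notMem_mul hq (notMem_pow hq hr n) ht) hs, ?_⟩
    exact J_left hf hg hfg (J_mono (by omega) hsJ)
      (fun N g i hv hi => hF N i r (hrJ N g i hv hi))

lemma lemma_S {p : Ideal R} (hp : p.IsPrime) {M : Type} [AddCommGroup M] [Module R M]
    {x s r : R} {c : ℕ} (hx : x ∈ p) (hs : s ∉ p) (hK : ∀ m : M, x • m = 0 → s • m = 0)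
    (hr : r ∉ p) (hrJ : r ∈ J R (c + 1) (QuotSMulTop x M))
    (H : ∀ Q : Ideal R, Q.IsPrime → Q < p → ¬ J R c M ≤ Q) : ∃ t ∉ p, t ∈ J R c M := by
  have : ∃ n : ℕ, ∃ s' ∉ p, s' * x ^ n ∈ J R c M := by
    by_contra! hcon
    obtain ⟨Q, hQ, hJQ, hdis⟩ := Ideal.exists_le_prime_disjoint (J R c M)
      (p.primeCompl ⊔ Submonoid.powers x) (by
        rw [Set.disjoint_left]
        intro y hy hy'
        obtain ⟨a, ha, b, ⟨n, rfl⟩, rfl⟩ := Submonoid.mem_sup.1 hy'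
        exact hcon n a ha hy)
    rw [Set.disjoint_left] at hdis
    refine H Q hQ (lt_of_le_of_ne (fun y hy => ?_) ?_) hJQ
    · by_contra hyp
      exact hdis hy (Submonoid.mem_sup_left (S := p.primeCompl) hyp)
    · rintro rfl
      exact hdis hx (Submonoid.mem_sup_right (Submonoid.mem_powers x))
  obtain ⟨n, s', hs', hJ⟩ := this
  refine ⟨(s * r) ^ n * s', notMem_mul hp (notMem_pow hp (notMem_mul hp hs hr) n) hs', ?_⟩
  intro N g i hv hi z
  rw [mul_smul]
  refine torsion_pow hK (fun j hj => hrJ N g j hv (by omega)) n _ ?_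
  rw [smul_smul, mul_comm]
  exact hJ N g i hv hi z

end Bounded

end S11


open CategoryTheory CategoryTheory.Abelian Pointwise

namespace S11

set_option linter.unusedSectionVars false

section DD

variable {R : Type} [CommRing R] [IsNoetherianRing R]

/-- `Ext^i(R/p, M)_p = 0` for `i < e`, i.e. `depth M_p ≥ e`. -/
def D (p : Ideal R) (M : Type) [AddCommGroup M] [Module R M] (e : ℕ) : Prop :=
  ∀ i < e, ∃ s ∉ p, Kill s (ModuleCat.of R (R ⧸ p)) M i

lemma regAt_D {p : Ideal R} (hp : p.IsPrime) (xs : List R) : ∀ (M : Type) [AddCommGroup M]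
    [Module R M], RegAt p xs M → D p M xs.length := by
  induction xs with
  | nil => intro M _ _ _ i hi; simp at hi
  | cons x xs ih =>
    intro M _ _ h i hi
    obtain ⟨hx, ⟨s, hs, hK⟩, hxs⟩ := h
    have : ∃ r ∉ p, ∀ j, j + 1 = i → Kill r (ModuleCat.of R (R ⧸ p)) (QuotSMulTop x M) j := by
      rcases i with _ | i
      · exact ⟨1, hp.one_notMem, fun j hj => by omega⟩
      · obtain ⟨r, hr, hr'⟩ := ih _ hxs i (by simpa using hi)
        refine ⟨r, hr, fun j hj => ?_⟩
        obtain rfl : j = i := by omega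
        exact hr'
    obtain ⟨r, hr, hr'⟩ := this
    exact ⟨s * r, notMem_mul hp hs hr, fun z => kill_torsion hK hr' z
      (Kill.of_smul_left (smul_quot_zero hx) i z)⟩

lemma notMem_ass {p : Ideal R} {M : Type} [AddCommGroup M] [Module R M] {s : R} (hs : s ∉ p)
    (h : Kill s (ModuleCat.of R (R ⧸ p)) M 0) : p ∉ associatedPrimes R M := by
  intro hass
  obtain ⟨_, f, hf⟩ := (isAssociatedPrime_iff_exists_injective_linearMap _ _).1 hass
  have h1 := h (Ext.mk₀ (ModuleCat.ofHom f))
  rw [← Ext.mk₀_smul, Ext.mk₀_eq_zero_iff] at h1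
  have h2 : s • f (Ideal.Quotient.mk p 1) = 0 := by
    have := congrArg (fun φ => φ.hom (Ideal.Quotient.mk p 1)) h1
    simpa using this
  rw [← map_smul, map_eq_zero_iff f hf, ← Ideal.Quotient.mk_eq_mk, ← Submodule.Quotient.mk_smul,
    Submodule.Quotient.mk_eq_zero] at h2
  exact hs (by simpa using h2)

lemma D_succ {p : Ideal R} (hp : p.IsPrime) {M : Type} [AddCommGroup M] [Module R M]
    [Module.Finite R M] {e : ℕ} (hD : D p M (e + 1)) :
    ∃ x ∈ p, ∃ s ∉ p, (∀ m : M, x • m = 0 → s • m = 0) ∧ D p (QuotSMulTop x M) e := by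
  obtain ⟨s0, hs0, hs0'⟩ := hD 0 (by omega)
  have hpass := notMem_ass hs0 hs0'
  have hex : ∃ x ∈ p, ∀ Q ∈ associatedPrimes R M, Q ≤ p → x ∉ Q := by
    by_contra! hcon
    obtain ⟨Q, hQ, hpQ⟩ := (p.subset_union_prime_finite
      (s := {Q ∈ associatedPrimes R M | Q ≤ p})
      ((associatedPrimes.finite R M).subset (fun _ h => h.1)) (f := id) 0 0
      fun _ h _ _ ↦ h.1.1).1 (by
        intro x hx
        obtain ⟨Q, h1, h2, h3⟩ := hcon x hx
        simp only [Set.mem_iUnion]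
        exact ⟨Q, ⟨h1, h2⟩, h3⟩)
    have : p = Q := le_antisymm hpQ hQ.2
    rw [this] at hpass
    exact hpass hQ.1
  obtain ⟨x, hx, hxQ⟩ := hex
  have hK : ∃ s ∉ p, ∀ m : M, x • m = 0 → s • m = 0 := by
    let K := LinearMap.ker (LinearMap.lsmul R M x)
    have hann : ¬ Module.annihilator R K ≤ p := by
      intro hle
      obtain ⟨P, hP, hPp⟩ := Ideal.exists_minimalPrimes_le hle
      have hPK := Module.associatedPrimes.minimalPrimes_annihilator_subset_associatedPrimes R K hP
      have hPM := associatedPrimes.subset_of_injective (Submodule.injective_subtype K) hPK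
      refine hxQ P hPM hPp ?_
      apply hP.1.2
      rw [Module.mem_annihilator]
      rintro ⟨m, hm⟩
      ext
      simpa [K] using hm
    obtain ⟨s, hs, hsp⟩ := SetLike.not_le_iff_exists.1 hann
    refine ⟨s, hsp, fun m hm => ?_⟩
    have := Module.mem_annihilator.1 hs ⟨m, by simpa [K] using hm⟩
    exact congrArg Subtype.val this
  obtain ⟨s, hs, hK⟩ := hK
  refine ⟨x, hx, s, hs, hK, fun i hi => ?_⟩
  obtain ⟨r, hr, hr'⟩ := hD i (by omega)
  obtain ⟨r2, hr2, hr2'⟩ := hD (i + 1) (by omega)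
  exact ⟨_, notMem_mul hp hr (notMem_mul hp hr2 hs), kill_quot hK hr' hr2'⟩

lemma det_trick {p : Ideal R} (hp : p.IsPrime) {E : Type} [AddCommGroup E] [Module R E]
    [Module.Finite R E] {z t : R} (hz : z ∈ p) (ht : t ∉ p) (h : ∀ y : E, ∃ y' : E, t • y = z • y') :
    ∃ s ∉ p, ∀ y : E, s • y = 0 := by
  obtain ⟨P, hP, -, hcoef, hae⟩ :=
    LinearMap.exists_monic_and_natDegree_eq_and_coeff_mem_pow_and_aeval_eq_zero R
      (algebraMap R (Module.End R E) t) (Ideal.span {z}) (by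
        rintro _ ⟨y, rfl⟩
        obtain ⟨y', hy'⟩ := h y
        rw [Module.algebraMap_end_apply, hy']
        exact Submodule.smul_mem_smul (Ideal.mem_span_singleton_self z) trivial)
  rw [Polynomial.aeval_algebraMap_apply] at hae
  refine ⟨Polynomial.aeval t P, ?_, fun y => ?_⟩
  · intro hmem
    apply notMem_pow hp ht P.natDegree
    rw [hP.as_sum] at hmem
    simp only [map_add, map_pow, Polynomial.aeval_X, map_sum, map_mul] at hmem
    refine (Ideal.add_mem_iff_left p (Ideal.sum_mem p fun k hk => ?_)).1 hmem
    apply Ideal.mul_mem_right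
    rw [Polynomial.aeval_C]
    have hk' : P.natDegree - k ≠ 0 := by
      have := Finset.mem_range.1 hk
      omega
    have := Ideal.pow_le_self hk' (hcoef k)
    exact (Ideal.span_singleton_le_iff_mem p).2 hz this
  · have := LinearMap.congr_fun hae y
    simpa using this

lemma D_consec {p Q : Ideal R} (hp : p.IsPrime) (hQ : Q.IsPrime) (hlt : Q < p)
    (hno : ∀ P : Ideal R, P.IsPrime → Q < P → P ≤ p → P = p)
    {M : Type} [AddCommGroup M] [Module R M] [Module.Finite R M] {e : ℕ} (hD : D p M (e + 1)) :
    D Q M e := by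
  intro i hi
  obtain ⟨z, hz, hzQ⟩ := SetLike.exists_of_lt hlt
  obtain ⟨t, ht, hK⟩ := F_lemma' hp (QuotSMulTop z (R ⧸ Q)) (by
    intro P hP hPp
    rw [Module.support_quotSMulTop, Set.mem_inter_iff, Module.mem_support_iff_of_finite,
      Ideal.annihilator_quotient] at hP
    refine hno _ P.2 (lt_of_le_of_ne hP.1 ?_) hPp
    intro h
    apply hzQ
    rw [h]
    simpa using hP.2) M (i + 1) (hD (i + 1) (by omega))
  have hS := sexact (f := LinearMap.lsmul R (R ⧸ Q) z) (g := (z • (⊤ : Submodule R (R ⧸ Q))).mkQ)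
    (by
      rw [injective_iff_map_eq_zero]
      exact fun m hm => notMem_smul_inj hQ hzQ m hm)
    (Submodule.mkQ_surjective _) (by
      intro y
      rw [Submodule.mkQ_apply, Submodule.Quotient.mk_eq_zero,
        Submodule.mem_smul_pointwise_iff_exists]
      simp)
  obtain ⟨s, hs, hs'⟩ := det_trick hp (E := Abelian.Ext.{0} (ModuleCat.of R (R ⧸ Q)) (ModuleCat.of R M) i)
    hz ht (by
      intro y
      obtain ⟨y', hy'⟩ := Ext.contravariant_sequence_exact₁ hS (ModuleCat.of R M) (n₁ := i + 1)
        (t • y) (by omega) (by rw [Ext.comp_smul]; exact hK _)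
      refine ⟨y', ?_⟩
      rw [← hy']
      have h1 : (Ext.mk₀ (𝟙 (ModuleCat.of R (R ⧸ Q)))).comp y' (zero_add i) = y' := by simp
      conv_rhs => rw [← h1]
      rw [← Ext.smul_comp, ← Ext.mk₀_smul]
      rfl)
  exact ⟨s, fun h => hs (hlt.le h), hs'⟩

end DD

end S11


open CategoryTheory CategoryTheory.Abelian Pointwise

namespace S11

set_option linter.unusedSectionVars false

section Main

variable {R : Type} [CommRing R] [IsNoetherianRing R]

lemma main_zero (hCM : IsCohenMacaulayRing R) {p : Ideal R} (hp : p.IsPrime) {n c : ℕ}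
    (hn : p.height = n) (hc : n ≤ c)
    (H : ∀ Q : Ideal R, Q.IsPrime → Q < p → ∀ (M : Type) [AddCommGroup M] [Module R M]
      [Module.Finite R M], ∃ s ∉ Q, s ∈ J R c M)
    (M : Type) [AddCommGroup M] [Module R M] [Module.Finite R M] : ∃ s ∉ p, s ∈ J R c M := by
  suffices H : ∀ I : Ideal R, ∀ (M : Type) [AddCommGroup M] [Module R M]
    [Module.Finite R M], (∀ r ∈ I, ∀ m : M, r • m = 0) → ∃ s ∉ p, s ∈ J R c M from
    H ⊥ M (fun r hr m => by rw [Ideal.mem_bot.1 hr, zero_smul])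
  intro I
  induction I using IsNoetherian.induction with
  | _ I IH =>
  intro M _ _ hM
  induction hM using IsNoetherianRing.induction_on_isQuotientEquivQuotientPrime R with
  | subsingleton N =>
    exact fun _ => ⟨1, hp.one_notMem, J_smul (fun m => Subsingleton.elim _ _) c⟩
  | quotient N q e =>
    intro hI
    suffices h : ∃ s ∉ p, s ∈ J R c (R ⧸ q.1) by
      obtain ⟨s, hs, h⟩ := h
      exact ⟨s, hs, J_equiv e.symm h⟩
    by_cases hqp : q.1 ≤ p
    swap
    · obtain ⟨t, ht, htq⟩ := SetLike.not_le_iff_exists.1 hqp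
      exact ⟨t, htq, J_smul (smul_quot_zero ht) c⟩
    rcases eq_or_lt_of_le hqp with heq | hlt
    · obtain ⟨s, hs, h⟩ := J_self hCM q.1 q.2 (d := n) (by rw [heq, hn])
      rw [heq] at hs
      exact ⟨s, hs, J_mono hc h⟩
    obtain ⟨t, htp, ht⟩ := SetLike.exists_of_lt hlt
    obtain ⟨r, hr, hrJ⟩ := IH (q.1 ⊔ Ideal.span {t}) (by
        have h1 : I ≤ q.1 := by
          intro r hr
          have := hI r hr (e.symm (Ideal.Quotient.mk q.1 1))
          rw [← map_smul, LinearEquiv.map_eq_zero_iff] at this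
          rw [← Ideal.Quotient.mk_eq_mk, ← Submodule.Quotient.mk_smul,
            Submodule.Quotient.mk_eq_zero] at this
          simpa using this
        refine lt_of_le_of_lt h1 (lt_of_le_of_ne le_sup_left (fun h => ht ?_))
        rw [h]
        exact Ideal.mem_sup_right (Ideal.mem_span_singleton_self t)) (QuotSMulTop t (R ⧸ q.1)) (by
        suffices h : q.1 ⊔ Ideal.span {t} ≤ Module.annihilator R (QuotSMulTop t (R ⧸ q.1)) from
          fun r hr => Module.mem_annihilator.1 (h hr)
        apply sup_le
        · intro r hr
          rw [Module.mem_annihilator]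
          intro m
          obtain ⟨m, rfl⟩ := Submodule.Quotient.mk_surjective _ m
          rw [← Submodule.Quotient.mk_smul, smul_quot_zero hr, Submodule.Quotient.mk_zero]
        · rw [Ideal.span_singleton_le_iff_mem]
          exact QuotSMulTop.mem_annihilator _ t)
    refine lemma_S hp htp hp.one_notMem (fun m hm => ?_) hr (J_mono (Nat.le_succ c) hrJ) ?_
    · rw [one_smul]; exact notMem_smul_inj q.2 ht m hm
    · intro Q hQ hQp hle
      obtain ⟨s, hs, h⟩ := H Q hQ hQp (R ⧸ q.1)
      exact hs (hle h)
  | exact N₁ N₂ N₃ f g hf hg h ih₁ ih₃ =>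
    intro hI
    obtain ⟨k₁, hk₁, h₁⟩ := ih₁ (fun r hr m => hf (by rw [map_smul, hI r hr, map_zero]))
    obtain ⟨k₃, hk₃, h₃⟩ := ih₃ (fun r hr m => by
      obtain ⟨m, rfl⟩ := hg m
      rw [← map_smul, hI r hr, map_zero])
    exact ⟨k₁ * k₃, notMem_mul hp hk₁ hk₃, J_mid hf hg h h₁ h₃⟩

lemma height_lt {Q p : Ideal R} (hp : p.IsPrime) (hQ : Q.IsPrime) (hlt : Q < p) {n : ℕ}
    (hn : p.height = n) : ∃ m : ℕ, Q.height = m ∧ m < n := by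
  obtain ⟨m, hm⟩ := exists_height Q hQ
  refine ⟨m, hm, ?_⟩
  have h3 := Ideal.height_add_one_le_of_lt_of_isPrime hlt
  rw [hm, hn] at h3
  have : m + 1 ≤ n := by exact_mod_cast h3
  omega

lemma main (hCM : IsCohenMacaulayRing R) (n : ℕ) : ∀ (p : Ideal R), p.IsPrime → p.height = n →
    ∀ (e c : ℕ) (M : Type) [AddCommGroup M] [Module R M] [Module.Finite R M],
    D p M e → n ≤ e + c → ∃ s ∉ p, s ∈ J R c M := by
  induction n using Nat.strong_induction_on with
  | _ n IH =>
  intro p hp hn e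
  induction e with
  | zero =>
    intro c M _ _ _ _ hle
    refine main_zero hCM hp hn (by omega) (fun Q hQ hlt M _ _ _ => ?_) M
    obtain ⟨m, hm, hmn⟩ := height_lt hp hQ hlt hn
    exact IH m hmn Q hQ hm 0 c M (fun i hi => by omega) (by omega)
  | succ e ihe =>
    intro c M _ _ _ hD hle
    obtain ⟨x, hx, s, hs, hK, hDq⟩ := D_succ hp hD
    obtain ⟨r, hr, hrJ⟩ := ihe (c + 1) (QuotSMulTop x M) hDq (by omega)
    refine lemma_S hp hx hs hK hr hrJ (fun Q hQ hlt hJQ => ?_)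
    obtain ⟨Q', ⟨hQ', hQQ', hlt'⟩, hmax⟩ := set_has_maximal_iff_noetherian.2
      (inferInstanceAs (IsNoetherian R R)) {P : Ideal R | P.IsPrime ∧ Q ≤ P ∧ P < p}
      ⟨Q, hQ, le_rfl, hlt⟩
    obtain ⟨m, hm, hmn⟩ := height_lt hp hQ' hlt' hn
    obtain ⟨t, ht, htJ⟩ := IH m hmn Q' hQ' hm e c M (D_consec hp hQ' hlt' (fun P hP h1 h2 => by
      by_contra hne
      exact hmax P ⟨hP, hQQ'.trans h1.le, lt_of_le_of_ne h2 hne⟩ h1) hD) (by omega)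
    exact ht (hQQ' (hJQ htJ))

/-- Ext-version of the theorem. -/
lemma ext_version (hCM : IsCohenMacaulayRing R)
    (p : Ideal R) [hp : p.IsPrime]
    (M : Type) [AddCommGroup M] [Module R M] [Module.Finite R M]
    (hMCM : Subsingleton (LocalizedModule p.primeCompl M) ∨
      (moduleDepthAt p M : WithBot ℕ∞) = ringKrullDim (Localization.AtPrime p)) :
    ∃ s ∉ p, s ∈ J R 0 M := by
  rcases hMCM with h | h
  · have h1 : (⟨p, hp⟩ : PrimeSpectrum R) ∉ Module.support R M := Module.notMem_support_iff.2 h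
    obtain ⟨s, hs, h⟩ := exists_single hp M (Module.notMem_support_iff'.1 h1)
    exact ⟨s, hs, J_smul h 0⟩
  · obtain ⟨xs, hxs, hlen⟩ := regAt_of_seqDepth p M _
      (LocalizedModule.mkLinearMap p.primeCompl M) h
    exact main hCM xs.length p hp hlen.symm xs.length 0 M (regAt_D hp xs M hxs) (by omega)

end Main

section Van

variable {R : Type} [CommRing R]

lemma van_aux (a : Ideal R) (n : ℕ) (rs : List R) : ∀ (M : Type) [AddCommGroup M] [Module R M],
    (∀ r ∈ rs, r ∈ a) → RingTheory.Sequence.IsWeaklyRegular M rs → ∀ i < rs.length,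
    Kill (1 : R) (ModuleCat.of R (R ⧸ a ^ n)) M i := by
  induction rs with
  | nil => intro M _ _ _ _ i hi; simp at hi
  | cons x xs ih =>
    intro M _ _ hmem hreg i hi
    rw [RingTheory.Sequence.isWeaklyRegular_cons_iff] at hreg
    intro z
    have hxn : x ^ n • z = 0 := by
      refine Kill.of_smul_left (fun m => ?_) i z
      obtain ⟨m, rfl⟩ := Ideal.Quotient.mk_surjective m
      rw [← Ideal.Quotient.mk_eq_mk, ← Submodule.Quotient.mk_smul, Submodule.Quotient.mk_eq_zero]
      exact (a ^ n).mul_mem_right m (Ideal.pow_mem_pow (hmem x List.mem_cons_self) n)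
    have key : ∀ (k : ℕ) (z : Abelian.Ext.{0} (ModuleCat.of R (R ⧸ a ^ n)) (ModuleCat.of R M) i),
        x ^ k • z = 0 → z = 0 := by
      intro k
      induction k with
      | zero => intro z hz; simpa using hz
      | succ k ihk =>
        intro z hz
        apply ihk
        have := kill_torsion (x := x) (s := 1) (r := 1) (M := M)
          (fun m hm => by rw [one_smul]; exact hreg.1 (by simpa using hm))
          (fun j hj => ih _ (fun r hr => hmem r (List.mem_cons_of_mem _ hr)) hreg.2 j (by
            simp at hi; omega)) (x ^ k • z) (by rw [smul_smul, ← pow_succ', hz])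
        simpa using this
    rw [one_smul]
    exact key n z hxn

lemma van_of_grade (a : Ideal R) (i : ℕ) (hi : (i : ℕ∞) < a.grade) :
    ∃ g, i < g ∧ ∀ n, Van (ModuleCat.of R (R ⧸ a ^ n)) g := by
  obtain ⟨g, ⟨rs, h1, h2, rfl⟩, hlt⟩ := lt_sSup_iff.1 hi
  exact ⟨rs.length, by exact_mod_cast hlt, fun n i hi => van_aux a n rs R h1 h2 i hi⟩

end Van

end S11

open CategoryTheory CategoryTheory.Abelian Pointwise
namespace S11
set_option linter.unusedSectionVars false

theorem homology_kill {R : Type} [CommRing R] (K : CochainComplex (ModuleCat.{0} R) ℕ) (n : ℕ) (s : R)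
    (h : ∀ f : K.X n, K.d n (n+1) f = 0 → ∃ (p : ℕ) (g : K.X p), K.d p n g = s • f)
    (x : K.homology n) : s • x = 0 := by
  obtain ⟨z, rfl⟩ := (ModuleCat.epi_iff_surjective (K.homologyπ n)).1 inferInstance x
  have hz : K.d n (n+1) (K.iCycles n z) = 0 := by
    rw [← ModuleCat.comp_apply, K.iCycles_d]; rfl
  obtain ⟨p, g, hg⟩ := h _ hz
  have e : K.toCycles p n g = s • z := by
    apply (ModuleCat.mono_iff_injective (K.iCycles n)).1 inferInstance
    rw [← ModuleCat.comp_apply, K.toCycles_i, hg, map_smul]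
  rw [← map_smul, ← e, ← ModuleCat.comp_apply, K.toCycles_comp_homologyπ]; rfl

theorem kill_zero {R : Type} [CommRing R] {N : ModuleCat.{0} R}
    {M : Type} [AddCommGroup M] [Module R M] (s : R) (hk : Kill s N M 0)
    (φ : N ⟶ ModuleCat.of R M) : s • φ = 0 := by
  have h1 := hk (Ext.mk₀ φ)
  rw [Ext.smul_eq_comp_mk₀, Ext.mk₀_comp_mk₀] at h1
  have h2 := (Ext.mk₀_eq_zero_iff _).1 h1
  simpa using h2

theorem colim_kill {R : Type} [CommRing R] {D : Type} [SmallCategory D]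
    {F : D ⥤ ModuleCat.{0} R} (c : Limits.Cocone F) (hc : Limits.IsColimit c) (s : R)
    (h : ∀ (j : D) (y : F.obj j), s • y = 0) (x : c.pt) : s • x = 0 := by
  have key : (ModuleCat.ofHom (s • LinearMap.id) : c.pt ⟶ c.pt) = 0 := by
    refine hc.hom_ext fun j => ?_
    refine ModuleCat.hom_ext (LinearMap.ext fun y => ?_)
    have e : s • (c.ι.app j).hom y = 0 := by rw [← map_smul, h, map_zero]
    exact e
  exact congrArg (fun f : c.pt ⟶ c.pt => f.hom x) key

theorem extMk_case {R : Type} [CommRing R] {N : ModuleCat.{0} R} (P : ProjectiveResolution N)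
    (M : Type) [AddCommGroup M] [Module R M] (s : R) (i : ℕ) (hk : Kill s N M i)
    (f : P.complex.X i ⟶ ModuleCat.of R M) (hf : P.complex.d (i+1) i ≫ f = 0) :
    ∃ (p : ℕ) (g : P.complex.X p ⟶ ModuleCat.of R M), P.complex.d i p ≫ g = s • f := by
  cases i with
  | zero =>
    refine ⟨0, 0, ?_⟩
    have hex := P.exact₀
    have : Epi (P.π.f 0) := inferInstance
    let φ := hex.desc f hf
    have hφ : P.π.f 0 ≫ φ = f := hex.g_desc f hf
    have h2 : s • φ = 0 := kill_zero s hk φ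
    rw [Limits.comp_zero, ← hφ, ← Linear.comp_smul]
    exact ((congrArg (fun t => P.π.f 0 ≫ t) h2).trans Limits.comp_zero).symm
  | succ p =>
    refine ⟨p, ?_⟩
    have h1 := hk (P.extMk f (p+2) rfl hf)
    rw [Ext.smul_eq_comp_mk₀, P.extMk_comp_mk₀] at h1
    obtain ⟨g, hg⟩ := (P.extMk_eq_zero_iff _ _ _ _ p rfl).1 h1
    exact ⟨g, by rw [hg]; simp⟩

theorem old_ext_kill {R : Type} [CommRing R] (N : ModuleCat.{0} R)
    (M : Type) [AddCommGroup M] [Module R M] (s : R) (i : ℕ) (hk : Kill s N M i)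
    (x : ((_root_.Ext R (ModuleCat.{0} R) i).obj (Opposite.op N)).obj (ModuleCat.of R M)) :
    s • x = 0 := by
  let P := projectiveResolution N
  let e := (P.isoExt (R := R) i (ModuleCat.of R M)).toLinearEquiv
  apply e.injective
  rw [map_smul, map_zero]
  apply homology_kill
  intro f hf
  exact extMk_case P M s i hk f hf

theorem lc_kill {R : Type} [CommRing R] (a : Ideal R)
    (M : Type) [AddCommGroup M] [Module R M] (s : R) (i : ℕ)
    (hk : ∀ n : ℕ, Kill s (ModuleCat.of R (R ⧸ a ^ n)) M i)
    (x : (localCohomology a i).obj (ModuleCat.of R M)) : s • x = 0 := by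
  have hc := Limits.isColimitOfPreserves ((evaluation (ModuleCat.{0} R) (ModuleCat.{0} R)).obj (ModuleCat.of R M))
    (Limits.colimit.isColimit (localCohomology.diagram (localCohomology.idealPowersDiagram a) i))
  exact colim_kill _ hc s (fun j y => old_ext_kill _ M s i (hk j.unop.unop) y) x
end S11

theorem stmt11 {R : Type} [CommRing R] [IsNoetherianRing R] (hCM : IsCohenMacaulayRing R)
    (p : Ideal R) [p.IsPrime]
    (M : Type) [AddCommGroup M] [Module R M] [Module.Finite R M]
    (hMCM : Subsingleton (LocalizedModule p.primeCompl M) ∨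
      (moduleDepthAt p M : WithBot ℕ∞) = ringKrullDim (Localization.AtPrime p)) :
    ∃ s ∉ p, ∀ (a : Ideal R) (i : ℕ), (i : ℕ∞) < a.grade →
      ∀ x : ((localCohomology a i).obj (ModuleCat.of R M)), s • x = 0 := by
  obtain ⟨s, hs, hJ⟩ := S11.ext_version hCM p M hMCM
  refine ⟨s, hs, fun a i hi x => ?_⟩
  obtain ⟨g, hig, hv⟩ := S11.van_of_grade a i hi
  exact S11.lc_kill a M s i (fun n => hJ _ g i (hv n) (by omega)) x
end

section
/- Let R be a Cohen-Macaulay commutative Noetherian ring, p a prime ideal, and M a finitely generated R-module such that there exists s ∈ R \ p with s·H^i_a(M) = 0 for all ideals a of R and all integers i < grade(a,R). Then M_p is a maximal Cohen-Macaulay R_p-module, i.e., M_p = 0 or depth M_p ≥ dim R_p. -/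
section Helpers

open CategoryTheory Abelian Limits Opposite

variable {R : Type} [CommRing R]

noncomputable def linYonMap {P Q : ChainComplex (ModuleCat.{0} R) ℕ} (φ : P ⟶ Q) (M : ModuleCat.{0} R) :
    Q.linearYonedaObj R M ⟶ P.linearYonedaObj R M :=
  (HomologicalComplex.unopFunctor _ _).map ((((linearYoneda R (ModuleCat.{0} R)).obj M).rightOp.mapHomologicalComplex _).map φ).op

lemma abs_nat {C : Type*} [Category C] {A B D E F G : C} (a : A ⟶ B) (b : B ⟶ D) (c : A ⟶ E) (d : E ⟶ D)
    (h : a ≫ b = c ≫ d) (U : F ≅ E) (U' : G ≅ D) (k : F ⟶ G) (h2 : U.hom ≫ d = k ≫ U'.hom) :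
    a ≫ (b ≫ U'.inv) = (c ≫ U.inv) ≫ k := by
  have : d ≫ U'.inv = U.inv ≫ k := by
    rw [Iso.comp_inv_eq, Category.assoc, ← h2, Iso.inv_hom_id_assoc]
  rw [← Category.assoc, h, Category.assoc, Category.assoc, this]

lemma oldExt_nat {X X' : ModuleCat.{0} R} (g : X' ⟶ X) (P : ProjectiveResolution X)
    (P' : ProjectiveResolution X') (φ : ProjectiveResolution.Hom P' P g) (M : ModuleCat.{0} R) (n : ℕ) :
    (((Ext R (ModuleCat.{0} R) n).map g.op).app M) ≫ (P'.isoExt n M).hom =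
      (P.isoExt n M).hom ≫ HomologicalComplex.homologyMap (linYonMap φ.hom M) n := by
  have h := ProjectiveResolution.isoLeftDerivedObj_inv_naturality g P' P φ.hom φ.hom_f_zero_comp_π_f_zero
    ((linearYoneda R (ModuleCat.{0} R)).obj M).rightOp n
  have h2 := HomologicalComplex.homologyOp_hom_naturality (linYonMap φ.hom M) n
  replace h := congrArg Quiver.Hom.unop h
  replace h2 := congrArg Quiver.Hom.unop h2
  exact abs_nat _ _ _ _ h (HomologicalComplex.homologyUnop _ n) (HomologicalComplex.homologyUnop _ n) _ h2

lemma homology_zero {K : CochainComplex (ModuleCat.{0} R) ℕ} (n : ℕ) (z : K.cycles n)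
    (h : K.homologyπ n z = 0) :
    ∃ y : K.X ((ComplexShape.up ℕ).prev n), K.d _ n y = K.iCycles n z := by
  have e : K.pOpcycles n (K.iCycles n z) = 0 := by
    have := K.homology_π_ι n
    have := congr($this z)
    simp only [ModuleCat.comp_apply] at this
    rw [← this, h, map_zero]
  exact (ShortComplex.moduleCat_pOpcycles_eq_zero_iff (K.sc n) _).1 e

lemma exists_cyc {K : CochainComplex (ModuleCat.{0} R) ℕ} (n : ℕ) (z : K.X n)
   (h : K.d n (n+1) z = 0) : ∃ y : K.cycles n, K.iCycles n y = z := 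
  ⟨K.cyclesMk z (n+1) (by simp) h, K.i_cyclesMk z (n+1) (by simp) h⟩

lemma oldExt_key {X : ModuleCat.{0} R} (P : ProjectiveResolution X) (M : ModuleCat.{0} R) (n : ℕ)
    (f : P.complex.X n ⟶ M) (hf : P.complex.d (n+1) n ≫ f = 0) :
    ∃ y : ((Ext R (ModuleCat.{0} R) n).obj (op X)).obj M, 
      ∀ {X' : ModuleCat.{0} R} (g : X' ⟶ X) (P' : ProjectiveResolution X') (φ : ProjectiveResolution.Hom P' P g)
      (s : R), ((Ext R (ModuleCat.{0} R) n).map g.op).app M (s • y) = 0 → 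
      ∃ h : P'.complex.X ((ComplexShape.up ℕ).prev n) ⟶ M, P'.complex.d n _ ≫ h = φ.hom.f n ≫ (s • f) := by
  obtain ⟨c, hc⟩ := exists_cyc (K := P.complex.linearYonedaObj R M) n f (by
    exact hf)
  refine ⟨(P.isoExt n M).inv ((P.complex.linearYonedaObj R M).homologyπ n c), ?_⟩
  intro X' g P' φ s H
  have h1 := oldExt_nat g P P' φ M n
  have h2 := congr($h1 ((P.isoExt n M).inv (s • (P.complex.linearYonedaObj R M).homologyπ n c)))
  simp only [ModuleCat.comp_apply] at h2
  rw [← map_smul] at H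
  rw [H, map_zero, Iso.inv_hom_id_apply, ← map_smul] at h2
  have h3 := HomologicalComplex.homologyπ_naturality (linYonMap φ.hom M) n
  have h4 := congr($h3 (s • c))
  simp only [ModuleCat.comp_apply] at h4
  rw [← h2] at h4
  obtain ⟨y, hy⟩ := homology_zero _ _ h4.symm
  refine ⟨y, ?_⟩
  have h5 := HomologicalComplex.cyclesMap_i (linYonMap φ.hom M) n
  have h6 := congr($h5 (s • c))
  simp only [ModuleCat.comp_apply] at h6
  rw [h6, map_smul, hc] at hy
  exact hy

lemma newExt_key {X : ModuleCat.{0} R} (M : ModuleCat.{0} R) (n : ℕ)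
    (z : Abelian.Ext X M n) :
    ∃ y : ((_root_.Ext R (ModuleCat.{0} R) n).obj (op X)).obj M, 
      ∀ {X' : ModuleCat.{0} R} (g : X' ⟶ X) (s : R), 
      ((_root_.Ext R (ModuleCat.{0} R) n).map g.op).app M (s • y) = 0 → 
      s • (Abelian.Ext.mk₀ g).comp z (zero_add n) = 0 := by
  let P := projectiveResolution X
  obtain ⟨f, hf, rfl⟩ := P.extMk_surjective z (n+1) rfl
  obtain ⟨y, hy⟩ := oldExt_key P M n f hf
  refine ⟨y, fun {X'} g s H => ?_⟩
  let P' := projectiveResolution X'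
  let φ : ProjectiveResolution.Hom P' P g := ⟨ProjectiveResolution.lift g P' P, by
    simpa using ProjectiveResolution.lift_commutes_zero g P' P⟩
  have hex := hy g P' φ s H
  rw [ProjectiveResolution.mk₀_comp_extMk _ _ _ _ φ, Abelian.Ext.smul_eq_comp_mk₀,
    ProjectiveResolution.extMk_comp_mk₀]
  have e : (φ.hom.f n ≫ f) ≫ (s • 𝟙 M) = φ.hom.f n ≫ (s • f) := by simp
  rcases n with _ | n
  · have : P'.complex.d 0 ((ComplexShape.up ℕ).prev 0) = 0 := P'.complex.shape _ _ (by simp)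
    obtain ⟨h, hh⟩ := hex
    rw [this, zero_comp] at hh
    simp only [e, ← hh]
    simp
  · rw [ProjectiveResolution.extMk_eq_zero_iff _ _ _ _ _ n rfl, e]
    have hp : (ComplexShape.up ℕ).prev (n+1) = n := by simp
    rw [hp] at hex
    exact hex

lemma lc_key (p : Ideal R) (M : ModuleCat.{0} R) (n : ℕ) (s : R)
    (hs : ∀ x : (localCohomology p n).obj M, s • x = 0) (k : ℕ)
    (z : Abelian.Ext (ModuleCat.of R (R ⧸ p ^ k)) M n) :
    ∃ (l : ℕ) (h : p ^ l ≤ p ^ k), s • (Abelian.Ext.mk₀ (ModuleCat.ofHom (Submodule.mapQ (p ^ l) (p ^ k) LinearMap.id h))).comp z (zero_add n) = 0 := by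
  obtain ⟨y, hy⟩ := newExt_key M n z
  let D := localCohomology.diagram (localCohomology.idealPowersDiagram p) n
  have := localCohomology.hasColimitDiagram.{0,0} (localCohomology.idealPowersDiagram p) n
  have hc := isColimitOfPreserves ((evaluation _ _).obj M) (colimit.isColimit D)
  have hh := Concrete.isColimit_exists_of_rep_eq _ hc (i := op (op k)) (j := op (op k)) (s • y) 0 (by
    rw [map_zero]
    exact (map_smul (ModuleCat.Hom.hom (((colimit.cocone D).ι.app (op (op k))).app M)) s y).trans (hs _))
  obtain ⟨⟨⟨l⟩⟩, f, g, hfg⟩ := hh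
  rw [map_zero] at hfg
  exact ⟨l, ((localCohomology.idealPowersDiagram p).map f.unop).down.down, hy _ s hfg⟩


def Tors (p : Ideal R) (X M : ModuleCat.{0} R) (n : ℕ) : Prop :=
  ∀ z : Abelian.Ext X M n, ∃ s ∉ p, s • z = 0

lemma tors_of_ann_left (p : Ideal R) (X M : ModuleCat.{0} R) (n : ℕ) (s : R) (hs : s ∉ p)
    (h : ∀ x : X, s • x = 0) : Tors p X M n := by
  intro z
  refine ⟨s, hs, ?_⟩
  have e : s • 𝟙 X = 0 := by
    ext x
    exact h x
  calc s • z = s • (Abelian.Ext.mk₀ (𝟙 X)).comp z (zero_add n) := by simp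
    _ = (Abelian.Ext.mk₀ (s • 𝟙 X)).comp z (zero_add n) := by
      rw [Abelian.Ext.mk₀_smul, Abelian.Ext.smul_comp]
    _ = 0 := by rw [e]; simp

lemma tors_of_ann_right (p : Ideal R) (X M : ModuleCat.{0} R) (n : ℕ) (s : R) (hs : s ∉ p)
    (h : ∀ x : M, s • x = 0) : Tors p X M n := by
  intro z
  refine ⟨s, hs, ?_⟩
  have e : s • 𝟙 M = 0 := by
    ext x
    exact h x
  rw [Abelian.Ext.smul_eq_comp_mk₀, e]
  simp

lemma tors_mid (p : Ideal R) [p.IsPrime] {S : ShortComplex (ModuleCat.{0} R)} (hS : S.ShortExact)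
    (M : ModuleCat.{0} R) (n : ℕ) (h1 : Tors p S.X₁ M n) (h3 : Tors p S.X₃ M n) :
    Tors p S.X₂ M n := by
  intro z
  obtain ⟨s, hs, e⟩ := h1 ((Abelian.Ext.mk₀ S.f).comp z (zero_add n))
  rw [← Abelian.Ext.comp_smul] at e
  obtain ⟨y, hy⟩ := Abelian.Ext.contravariant_sequence_exact₂ hS _ _ e
  obtain ⟨t, ht, e2⟩ := h3 y
  refine ⟨t * s, fun h => (Ideal.IsPrime.mem_or_mem ‹_› h).elim ht hs, ?_⟩
  rw [mul_smul, ← hy, ← Abelian.Ext.comp_smul, e2]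
  simp

lemma tors_right₃ (p : Ideal R) [p.IsPrime] {S : ShortComplex (ModuleCat.{0} R)} (hS : S.ShortExact)
    (X : ModuleCat.{0} R) (n : ℕ) (h2 : Tors p X S.X₂ n) (h1 : Tors p X S.X₁ (n + 1)) :
    Tors p X S.X₃ n := by
  intro z
  obtain ⟨s, hs, e⟩ := h1 (z.comp hS.extClass rfl)
  rw [← Abelian.Ext.smul_comp] at e
  obtain ⟨y, hy⟩ := Abelian.Ext.covariant_sequence_exact₃ _ hS _ rfl e
  obtain ⟨t, ht, e2⟩ := h2 y
  refine ⟨t * s, fun h => (Ideal.IsPrime.mem_or_mem ‹_› h).elim ht hs, ?_⟩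
  rw [mul_smul, ← hy, ← Abelian.Ext.smul_comp, e2]
  simp

lemma tors_iso (p : Ideal R) {X Y : ModuleCat.{0} R} (f : X ≅ Y)
    (M : ModuleCat.{0} R) (n : ℕ) (h : Tors p X M n) : Tors p Y M n := by
  intro z
  obtain ⟨s, hs, e⟩ := h ((Abelian.Ext.mk₀ f.hom).comp z (zero_add n))
  refine ⟨s, hs, ?_⟩
  have := congrArg (fun w => (Abelian.Ext.mk₀ f.inv).comp w (zero_add n)) e
  simpa [← Abelian.Ext.comp_smul] using this

lemma tors_filt [IsNoetherianRing R] (p : Ideal R) [p.IsPrime] (M : ModuleCat.{0} R) (n : ℕ)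
    (h : Tors p (ModuleCat.of R (R ⧸ p)) M n) (k : ℕ)
    (N : Type) [AddCommGroup N] [Module R N] (hN : Module.Finite R N) :
    (∀ r ∈ p ^ k, ∀ x : N, r • x = 0) → Tors p (ModuleCat.of R N) M n := by
  induction hN using IsNoetherianRing.induction_on_isQuotientEquivQuotientPrime R with
  | subsingleton N =>
    intro _
    exact tors_of_ann_left p _ M n 1 ((Ideal.ne_top_iff_one p).1 (Ideal.IsPrime.ne_top ‹_›))
      (fun x => Subsingleton.elim (α := N) _ _)
  | quotient N q f =>
    intro hk
    have hq : p ≤ q.1 := by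
      refine Ideal.IsPrime.le_of_pow_le (hP := q.2) (n := k) fun r hr => ?_
      have := hk r hr (f.symm (Ideal.Quotient.mk _ 1))
      rw [← map_smul, LinearEquiv.map_eq_zero_iff] at this
      have h2 : (Ideal.Quotient.mk q.1) (r * 1) = 0 := this
      rwa [mul_one, Ideal.Quotient.eq_zero_iff_mem] at h2
    by_cases e : p = q.1
    · rw [← e] at f
      exact tors_iso p f.symm.toModuleIso M n h
    · obtain ⟨s, hs, hs'⟩ := SetLike.exists_of_lt (lt_of_le_of_ne hq e)
      refine tors_of_ann_left p _ M n s hs' fun (x : N) => ?_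
      apply f.injective
      rw [map_smul, map_zero]
      obtain ⟨y, hy⟩ := Ideal.Quotient.mk_surjective (f x)
      rw [← hy]
      exact Ideal.Quotient.eq_zero_iff_mem.2 (Ideal.mul_mem_right _ _ hs)
  | exact N₁ N₂ N₃ f g hf hg hfg h1 h3 =>
    intro hk
    let S : ShortComplex (ModuleCat.{0} R) := ShortComplex.mk (ModuleCat.ofHom f) (ModuleCat.ofHom g)
      (by ext x; exact hfg.apply_apply_eq_zero x)
    have hS : S.ShortExact :=
      { exact := (ShortComplex.ShortExact.moduleCat_exact_iff_function_exact _).mpr hfg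
        mono_f := (ModuleCat.mono_iff_injective _).mpr hf
        epi_g := (ModuleCat.epi_iff_surjective _).mpr hg }
    refine tors_mid p hS M n (h1 ?_) (h3 ?_)
    · intro r hr x
      apply hf
      rw [map_smul, map_zero, hk r hr]
    · intro r hr x
      obtain ⟨y, rfl⟩ := hg x
      rw [← map_smul, hk r hr, map_zero]

lemma tors_main [IsNoetherianRing R] (p : Ideal R) [p.IsPrime] (M : ModuleCat.{0} R) (t : ℕ)
    (s : R) (hs : s ∉ p)
    (h : ∀ i < t, ∀ x : (localCohomology p i).obj M, s • x = 0) :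
    ∀ i < t, Tors p (ModuleCat.of R (R ⧸ p)) M i := by
  obtain ⟨k, hk⟩ : ∃ k : ℕ, k = 1 := ⟨1, rfl⟩
  have iso1 : ModuleCat.of R (R ⧸ p ^ k) ≅ ModuleCat.of R (R ⧸ p) :=
    (Submodule.quotEquivOfEq _ _ (by rw [hk, pow_one])).toModuleIso
  intro i
  induction i with
  | zero =>
    intro hi
    refine tors_iso p iso1 M 0 fun z => ?_
    obtain ⟨l, hl, e⟩ := lc_key p M 0 s (h 0 hi) k z
    refine ⟨s, hs, ?_⟩
    rw [← Abelian.Ext.comp_smul] at e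
    have : Epi (ModuleCat.ofHom (Submodule.mapQ (p ^ l) (p ^ k) LinearMap.id hl)) := by
      rw [ModuleCat.epi_iff_surjective]
      intro x
      obtain ⟨y, rfl⟩ := Submodule.Quotient.mk_surjective _ x
      exact ⟨Submodule.Quotient.mk y, rfl⟩
    apply Abelian.Ext.precomp_mk₀_injective_of_epi M (ModuleCat.ofHom (Submodule.mapQ (p ^ l) (p ^ k) LinearMap.id hl))
    rw [map_zero]
    exact e
  | succ i ih =>
    intro hi
    refine tors_iso p iso1 M (i+1) fun z => ?_
    obtain ⟨l, hl, e⟩ := lc_key p M (i+1) s (h _ hi) k z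
    rw [← Abelian.Ext.comp_smul] at e
    have hsurj : Function.Surjective (Submodule.mapQ (p ^ l) (p ^ k) LinearMap.id hl) := by
      intro x
      obtain ⟨y, rfl⟩ := Submodule.Quotient.mk_surjective _ x
      exact ⟨Submodule.Quotient.mk y, rfl⟩
    have hS := LinearMap.shortExact_shortComplexKer hsurj
    obtain ⟨y, hy⟩ := Abelian.Ext.contravariant_sequence_exact₃ hS M (s • z) e (add_comm 1 i)
    have ht := tors_filt p M i (ih (by omega)) l (LinearMap.ker (Submodule.mapQ (p ^ l) (p ^ k) LinearMap.id hl))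
      inferInstance (by
        rintro r hr ⟨x, hx⟩
        ext
        obtain ⟨y, rfl⟩ := Submodule.Quotient.mk_surjective _ x
        show Submodule.Quotient.mk (p := p ^ l) (r • y) = 0
        rw [Submodule.Quotient.mk_eq_zero]
        exact Ideal.mul_mem_right _ _ hr)
    obtain ⟨t, ht, e2⟩ := ht y
    refine ⟨t * s, fun h => (Ideal.IsPrime.mem_or_mem ‹_› h).elim ht hs, ?_⟩
    rw [mul_smul, ← hy, ← Abelian.Ext.comp_smul, e2]
    simp

lemma exists_common_ann (p : Ideal R) [p.IsPrime] (T : Type) [AddCommGroup T] [Module R T]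
    [Module.Finite R T] (h : ∀ x : T, ∃ s ∉ p, s • x = 0) : ∃ s ∉ p, ∀ x : T, s • x = 0 := by
  obtain ⟨F, hF⟩ := Module.Finite.fg_top (R := R) (M := T)
  choose g hg hg' using h
  refine ⟨∏ x ∈ F, g x, fun hp => ?_, fun x => ?_⟩
  · obtain ⟨a, _, ha⟩ := (Ideal.IsPrime.prod_mem_iff).1 hp
    exact hg a ha
  · have hx : x ∈ Submodule.span R (F : Set T) := by rw [hF]; trivial
    induction hx using Submodule.span_induction with
    | mem x hx =>
      obtain ⟨c, hc⟩ := Finset.dvd_prod_of_mem g hx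
      rw [hc, mul_comm, mul_smul, hg', smul_zero]
    | zero => simp
    | add x y _ _ h1 h2 => rw [smul_add, h1, h2, add_zero]
    | smul a x _ h1 => rw [smul_comm, h1, smul_zero]

lemma quot_loc (p : Ideal R) [p.IsPrime] {M N : Type} [AddCommGroup M] [Module R M]
    [AddCommGroup N] [Module R N] (f : M →ₗ[R] N) [hf : IsLocalizedModule p.primeCompl f] :
    IsLocalizedModule p.primeCompl ((LinearMap.ker f).liftQ f le_rfl) where
  map_units := hf.map_units
  surj y := by
    obtain ⟨⟨m, s⟩, h⟩ := hf.surj y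
    exact ⟨⟨Submodule.Quotient.mk m, s⟩, h⟩
  exists_of_eq {a b} h := by
    obtain ⟨a, rfl⟩ := Submodule.Quotient.mk_surjective _ a
    obtain ⟨b, rfl⟩ := Submodule.Quotient.mk_surjective _ b
    have h' : f a = f b := h
    obtain ⟨c, hc⟩ := hf.exists_of_eq h'
    refine ⟨c, ?_⟩
    have := congrArg (Submodule.Quotient.mk (p := LinearMap.ker f)) hc
    exact this

open TensorProduct RingTheory.Sequence in
lemma rees_tors [IsNoetherianRing R] (p : Ideal R) [p.IsPrime] (n : ℕ) :
    ∀ (M : Type) [AddCommGroup M] [Module R M] [Module.Finite R M],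
    (∀ i < n, Tors p (ModuleCat.of R (R ⧸ p)) (ModuleCat.of R M) i) →
    ∃ rs : List R, (∀ r ∈ rs, r ∈ p) ∧
      IsWeaklyRegular (Localization.AtPrime p ⊗[R] M) (rs.map (algebraMap R (Localization.AtPrime p))) ∧
      rs.length = n := by
  induction n with
  | zero => exact fun M _ _ _ _ => ⟨[], by simp⟩
  | succ n ih =>
    intro M _ _ _ h
    let A := Localization.AtPrime p
    let f : M →ₗ[R] A ⊗[R] M := TensorProduct.mk R A M 1
    have hf : IsLocalizedModule p.primeCompl f :=
      (isLocalizedModule_iff_isBaseChange p.primeCompl A f).2 (TensorProduct.isBaseChange R M A)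
    let T := LinearMap.ker f
    let M' := M ⧸ T
    let g : M' →ₗ[R] A ⊗[R] M := T.liftQ f le_rfl
    have hg : IsLocalizedModule p.primeCompl g := quot_loc p f
    have hgb : IsBaseChange A g := (isLocalizedModule_iff_isBaseChange p.primeCompl A g).1 hg
    have hginj : Function.Injective g := LinearMap.ker_eq_bot.1 (Submodule.ker_liftQ_eq_bot' _ _ rfl)
    obtain ⟨t, ht, htT⟩ := exists_common_ann p T (by
      rintro ⟨x, hx⟩
      obtain ⟨c, hc⟩ := (IsLocalizedModule.eq_zero_iff p.primeCompl f).1 hx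
      exact ⟨c, c.2, by ext; exact hc⟩)
    have hS := LinearMap.shortExact_shortComplexKer (Submodule.mkQ_surjective T)
    have h' : ∀ i < n + 1, Tors p (ModuleCat.of R (R ⧸ p)) (ModuleCat.of R M') i := by
      intro i hi
      refine tors_right₃ p hS _ i (h i hi) (tors_of_ann_right p _ _ _ t ht ?_)
      rintro ⟨x, hx⟩
      ext
      have hx' := hx
      rw [Submodule.ker_mkQ] at hx'
      have h0 : t • x = 0 := congrArg Subtype.val (htT ⟨x, hx'⟩)
      exact h0
    have hsub : Subsingleton ((R ⧸ p) →ₗ[R] M') := by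
      refine ⟨fun a b => ?_⟩
      rw [← sub_eq_zero]
      generalize a - b = φ
      obtain ⟨s, hs, e⟩ := h' 0 (by omega) (Abelian.Ext.mk₀ (ModuleCat.ofHom φ))
      rw [← Abelian.Ext.mk₀_smul, Abelian.Ext.mk₀_eq_zero_iff] at e
      have e' : s • φ = 0 := by
        have := congrArg ModuleCat.Hom.hom e
        exact this
      ext
      have := DFunLike.congr_fun e' (Submodule.Quotient.mk 1)
      apply hginj
      refine IsLocalizedModule.smul_injective g (⟨s, hs⟩ : p.primeCompl) ?_
      show s • g (φ (Submodule.Quotient.mk 1)) = s • g 0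
      rw [map_zero, smul_zero, ← map_smul g]
      exact (congrArg g this).trans (map_zero g)
    obtain ⟨x, hx, hreg⟩ := IsSMulRegular.subsingleton_linearMap_iff.1 hsub
    rw [Ideal.annihilator_quotient] at hx
    obtain ⟨rs, h1, h2, h3⟩ := ih (QuotSMulTop x M') (fun i hi =>
      tors_right₃ p (IsSMulRegular.smulShortComplex_shortExact (M := ModuleCat.of R M') hreg) _ i
        (h' i (by omega)) (h' (i + 1) (by omega)))
    refine ⟨x :: rs, by simpa using ⟨hx, h1⟩, ?_, by simp [h3]⟩
    rw [← LinearEquiv.isWeaklyRegular_congr hgb.equiv, List.map_cons, isWeaklyRegular_cons_iff]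
    refine ⟨IsSMulRegular.of_flat_of_isBaseChange (TensorProduct.isBaseChange R M' A) hreg, ?_⟩
    rwa [LinearEquiv.isWeaklyRegular_congr (QuotSMulTop.algebraMapTensorEquivTensorQuotSMulTop x M' A)]

open RingTheory.Sequence in
lemma rees_final [IsNoetherianRing R] (p : Ideal R) [p.IsPrime] (n : ℕ)
    (M : Type) [AddCommGroup M] [Module R M] [Module.Finite R M]
    (h : ∀ i < n, Tors p (ModuleCat.of R (R ⧸ p)) (ModuleCat.of R M) i) :
    ∃ rs : List (Localization.AtPrime p), (∀ r ∈ rs, r ∈ IsLocalRing.maximalIdeal (Localization.AtPrime p)) ∧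
      IsWeaklyRegular (LocalizedModule p.primeCompl M) rs ∧
      rs.length = n := by
  obtain ⟨rs, h1, h2, h3⟩ := rees_tors p n M h
  refine ⟨_, ?_, ((LocalizedModule.equivTensorProduct p.primeCompl M).isWeaklyRegular_congr _).2 h2, by simp [h3]⟩
  simp only [List.mem_map]
  rintro _ ⟨r, hr, rfl⟩
  exact (IsLocalization.AtPrime.to_map_mem_maximal_iff _ p r).2 (h1 r hr)

open RingTheory.Sequence in
lemma hom_quot_subsingleton {A : Type} [CommRing A] (N : ModuleCat.{0} A) (rs : List A) :
    ∀ (M : Type) [AddCommGroup M] [Module A M], IsWeaklyRegular M rs →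
    (∀ i ≤ rs.length, Subsingleton (Abelian.Ext N (ModuleCat.of A M) i)) →
    Subsingleton (N →ₗ[A] (M ⧸ (Ideal.ofList rs • ⊤ : Submodule A M))) := by
  induction rs with
  | nil =>
    intro M _ _ _ h
    have e : (M ⧸ (Ideal.ofList ([] : List A) • ⊤ : Submodule A M)) ≃ₗ[A] M :=
      Submodule.quotEquivOfEqBot _ (by rw [Ideal.ofList_nil, Submodule.bot_smul])
    have : Subsingleton (N →ₗ[A] M) :=
      (Abelian.Ext.addEquiv₀.trans (ModuleCat.homAddEquiv (M := N) (N := ModuleCat.of A M))).subsingleton_congr.1 (h 0 le_rfl)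
    exact (LinearEquiv.congrRight e).toEquiv.subsingleton
  | cons x rs ih =>
    intro M _ _ hreg h
    rw [isWeaklyRegular_cons_iff] at hreg
    have := ih (QuotSMulTop x M) hreg.2 (by
      intro i hi
      have zero1 := AddCommGrpCat.isZero_of_iff_subsingleton.mpr (h i (by simp; omega))
      have zero2 := AddCommGrpCat.isZero_of_iff_subsingleton.mpr (h (i + 1) (by simp; omega))
      exact AddCommGrpCat.subsingleton_of_isZero <| ShortComplex.Exact.isZero_of_both_zeros
        ((Abelian.Ext.covariant_sequence_exact₃' N (IsSMulRegular.smulShortComplex_shortExact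
          (M := ModuleCat.of A M) hreg.1)) i (i + 1) rfl)
        (zero1.eq_zero_of_src _) (zero2.eq_zero_of_tgt _))
    exact (LinearEquiv.congrRight (Submodule.quotOfListConsSMulTopEquivQuotSMulTopInner M x rs)).toEquiv.subsingleton

open RingTheory.Sequence in
lemma local_contra [IsNoetherianRing R] (q : Ideal R) [q.IsPrime] (rs : List R)
    (hrs : IsWeaklyRegular R rs) (hd : (rs.length : ℕ∞) < ringDepthAt R q)
    (r : R) (hr : ∀ a, a ∈ q ↔ a * r ∈ Ideal.ofList rs) : False := by
  let A := Localization.AtPrime q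
  obtain ⟨_, ⟨ss, hss, hreg, rfl⟩, hlt⟩ := lt_sSup_iff.1 hd
  rw [Nat.cast_lt] at hlt
  have hreg' : IsRegular A ss :=
    (IsLocalRing.isRegular_iff_isWeaklyRegular_of_subset_maximalIdeal hss).2 hreg
  have : IsNoetherianRing A := IsLocalization.isNoetherianRing q.primeCompl A inferInstance
  let m := IsLocalRing.maximalIdeal A
  let N := ModuleCat.of A (A ⧸ m)
  have hN : Module.Finite A N := inferInstanceAs (Module.Finite A (A ⧸ m))
  have hext := ModuleCat.subsingleton_ext_of_exists_isRegular m N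
    (by rw [Module.support_eq_zeroLocus]
        exact (congrArg (fun I : Ideal A => PrimeSpectrum.zeroLocus (I : Set A)) (Ideal.annihilator_quotient (I := m))).le)
    (ModuleCat.of A A) (by
      show m • (⊤ : Submodule A A) < ⊤
      rw [smul_eq_mul, Ideal.mul_top]
      exact lt_top_iff_ne_top.2 (Ideal.IsPrime.ne_top inferInstance)) ss hss hreg'
  have hrs' : IsWeaklyRegular A (rs.map (algebraMap R A)) := hrs.of_isLocalization A q.primeCompl
  have hsub := hom_quot_subsingleton N _ A hrs' (fun i hi => hext i (by simp at hi; omega))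
  set J : Ideal A := Ideal.ofList (rs.map (algebraMap R A)) • ⊤ with hJ
  have hJ' : J = Ideal.map (algebraMap R A) (Ideal.ofList rs) := by
    rw [hJ, smul_eq_mul, Ideal.mul_top, Ideal.map_ofList]
  have hker : m ≤ LinearMap.ker (LinearMap.toSpanSingleton A (A ⧸ J) (Submodule.Quotient.mk (algebraMap R A r))) := by
    have : m = Ideal.map (algebraMap R A) q := (IsLocalization.AtPrime.map_eq_maximalIdeal q A).symm
    rw [this, Ideal.map_le_iff_le_comap]
    intro a ha
    rw [Ideal.mem_comap, LinearMap.mem_ker, LinearMap.toSpanSingleton_apply, ← Submodule.Quotient.mk_smul,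
      Submodule.Quotient.mk_eq_zero, hJ', smul_eq_mul, ← map_mul]
    exact Ideal.mem_map_of_mem _ ((hr a).1 ha)
  have h0 : Submodule.liftQ m _ hker = 0 := hsub.elim _ _
  have h1 := DFunLike.congr_fun h0 (Submodule.Quotient.mk 1)
  rw [Submodule.liftQ_apply, LinearMap.toSpanSingleton_apply, one_smul, LinearMap.zero_apply,
    Submodule.Quotient.mk_eq_zero, hJ', IsLocalization.algebraMap_mem_map_algebraMap_iff q.primeCompl] at h1
  obtain ⟨a, ha, har⟩ := h1
  exact ha ((hr a).2 har)

open RingTheory.Sequence in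
lemma grade_step [IsNoetherianRing R] (hCM : IsCohenMacaulayRing R) (p : Ideal R) [hp : p.IsPrime]
    (rs : List R) (hrs : IsWeaklyRegular R rs) (hd : (rs.length : ℕ∞) < ringDepthAt R p) :
    ∃ x ∈ p, IsSMulRegular (R ⧸ (Ideal.ofList rs • ⊤ : Submodule R R)) x := by
  by_contra hcon
  have hns : ¬ Subsingleton ((R ⧸ p) →ₗ[R] (R ⧸ (Ideal.ofList rs • ⊤ : Submodule R R))) := by
    rw [IsSMulRegular.subsingleton_linearMap_iff, Ideal.annihilator_quotient]
    exact hcon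
  rw [not_subsingleton_iff_nontrivial] at hns
  obtain ⟨φ, hφ⟩ := exists_ne (0 : (R ⧸ p) →ₗ[R] (R ⧸ (Ideal.ofList rs • ⊤ : Submodule R R)))
  have hm : φ (Submodule.Quotient.mk 1) ≠ 0 := by
    intro h
    apply hφ
    ext
    exact h
  obtain ⟨q, hq, hle⟩ := exists_le_isAssociatedPrime_of_isNoetherianRing R _ hm
  obtain ⟨hqp, y, hy⟩ := isAssociatedPrime_iff.1 hq
  have hpq : p ≤ q := by
    refine le_trans ?_ hle
    intro a ha
    rw [Submodule.mem_colon_singleton, Submodule.mem_bot, ← map_smul, ← Submodule.Quotient.mk_smul,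
      (Submodule.Quotient.mk_eq_zero p).2, map_zero]
    simpa using ha
  obtain ⟨r, rfl⟩ := Submodule.Quotient.mk_surjective _ y
  refine local_contra q rs hrs (lt_of_lt_of_le hd ?_) r fun a => ?_
  · rw [← WithBot.coe_le_coe]
    have h1 := hCM p hp
    have h2 := hCM q hqp
    rw [IsLocalization.AtPrime.ringKrullDim_eq_height p] at h1
    rw [IsLocalization.AtPrime.ringKrullDim_eq_height q] at h2
    rw [h1, h2, WithBot.coe_le_coe]
    exact Ideal.height_mono hpq
  · rw [hy, Submodule.mem_colon_singleton, Submodule.mem_bot, ← Submodule.Quotient.mk_smul,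
      Submodule.Quotient.mk_eq_zero, smul_eq_mul, smul_eq_mul, Ideal.mul_top]

open RingTheory.Sequence in
lemma grade_ge [IsNoetherianRing R] (hCM : IsCohenMacaulayRing R) (p : Ideal R) [hp : p.IsPrime]
    (n : ℕ) (hn : (n : ℕ∞) ≤ ringDepthAt R p) :
    ∃ rs : List R, (∀ r ∈ rs, r ∈ p) ∧ IsWeaklyRegular R rs ∧ rs.length = n := by
  induction n with
  | zero => exact ⟨[], by simp⟩
  | succ n ih =>
    have hlt : (n : ℕ∞) < ringDepthAt R p := lt_of_lt_of_le (by exact_mod_cast Nat.lt_succ_self n) hn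
    obtain ⟨rs, h1, h2, h3⟩ := ih hlt.le
    obtain ⟨x, hx, hreg⟩ := grade_step hCM p rs h2 (by rwa [h3])
    refine ⟨rs ++ [x], ?_, ?_, by simp [h3]⟩
    · intro r hr
      rcases List.mem_append.1 hr with h | h
      · exact h1 r h
      · rw [List.mem_singleton.1 h]; exact hx
    · rw [isWeaklyRegular_append_iff, isWeaklyRegular_singleton_iff]
      exact ⟨h2, hreg⟩

end Helpers

theorem stmt12 {R : Type} [CommRing R] [IsNoetherianRing R] (hCM : IsCohenMacaulayRing R)
    (p : Ideal R) [p.IsPrime]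
    (M : Type) [AddCommGroup M] [Module R M] [Module.Finite R M]
    (h : ∃ s ∉ p, ∀ (a : Ideal R) (i : ℕ), (i : ℕ∞) < a.grade →
      ∀ x : ((localCohomology a i).obj (ModuleCat.of R M)), s • x = 0) :
    Subsingleton (LocalizedModule p.primeCompl M) ∨
      ringKrullDim (Localization.AtPrime p) ≤ (moduleDepthAt p M : WithBot ℕ∞) := by
  obtain ⟨s, hs, h⟩ := h
  right
  rw [← hCM p inferInstance, WithBot.coe_le_coe, ← ENat.forall_natCast_le_iff_le]
  intro n hn
  obtain ⟨rs, h1, h2, h3⟩ := grade_ge hCM p n hn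
  have hg : (n : ℕ∞) ≤ p.grade := le_sSup ⟨rs, h1, h2, by rw [h3]⟩
  have ht := tors_main p (ModuleCat.of R M) n s hs fun i hi x =>
    h p i (lt_of_lt_of_le (by exact_mod_cast hi) hg) x
  obtain ⟨ss, g1, g2, g3⟩ := rees_final p n M ht
  exact le_sSup ⟨ss, g1, g2, by rw [g3]⟩
end
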